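/- Let ν ∈ (0,1), let M : (0,∞) → (0,∞) be slowly varying, and let w : ℕ₀ → (0,∞) satisfy w(n) M(n) n^{1−ν} → 1 as n → ∞. Fix δ̂ ∈ ℝ and set δ_N := δ̂ M(N) N^{−ν} for N ∈ ℕ. Then for every T > 0, sup_{t ∈ [0,T]} |Ψ^c_{δ_N}(Nt) − Ψ̂^{ν,c}_{δ̂}(t)| → 0 as N → ∞, where Ψ^c_δ is extended to real arguments by linear interpolation; moreover Ψ̂^{ν,c}_{δ̂}(t) is finite for every t ≥ 0. -/

import Mathlib

open MeasureTheory
open scoped ENNReal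

/-- Product of `w` over the successive gaps of a list, starting from `prev`. -/
noncomputable def gapProd (w : ℕ → ℝ) : ℕ → List ℕ → ℝ
  | _, [] => 1
  | prev, n :: rest => w (n - prev) * gapProd w n rest

/-- Discrete constrained partition function
`Ψ^c_δ(N) = 1 + Σ_{k=1}^{N-1} (e^δ-1)^k Σ_{0<n₁<⋯<n_k<N} (∏ w(nᵢ-nᵢ₋₁)) w(N-n_k)/w(N)`,
with `Ψ^c_δ(0) = Ψ^c_δ(1) = 1`. -/
noncomputable def PsiCons (w : ℕ → ℝ) (δ : ℝ) (N : ℕ) : ℝ :=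
  1 + ∑ k ∈ Finset.Icc 1 (N - 1), (Real.exp δ - 1) ^ k *
      ∑ s ∈ (Finset.Ioo 0 N).powersetCard k,
        gapProd w 0 (s.sort (· ≤ ·) ++ [N]) / w N

/-- Discrete free partition function
`Ψ_δ(N) = 1 + Σ_{k=1}^{N} (e^δ-1)^k Σ_{0<n₁<⋯<n_k≤N} ∏ w(nᵢ-nᵢ₋₁)`, with `Ψ_δ(0) = 1`. -/
noncomputable def PsiFree (w : ℕ → ℝ) (δ : ℝ) (N : ℕ) : ℝ :=
  1 + ∑ k ∈ Finset.Icc 1 N, (Real.exp δ - 1) ^ k *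
      ∑ s ∈ (Finset.Icc 1 N).powersetCard k,
        gapProd w 0 (s.sort (· ≤ ·))

/-- Linear interpolation of `F : ℕ → ℝ` between consecutive integers. -/
noncomputable def interp (F : ℕ → ℝ) (x : ℝ) : ℝ :=
  F ⌊x⌋₊ + (x - ⌊x⌋₊) * (F (⌊x⌋₊ + 1) - F ⌊x⌋₊)

/-- The gap `vᵢ - vᵢ₋₁` (with `v₋₁ := 0`) of a vector `v : Fin k → ℝ`. -/
noncomputable def gapR {k : ℕ} (v : Fin k → ℝ) (i : Fin k) : ℝ :=
  v i - (if _h : (i : ℕ) = 0 then 0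
    else v ⟨(i : ℕ) - 1, lt_of_le_of_lt (Nat.sub_le _ _) i.isLt⟩)

/-- The `(k+1)`-fold simplex integral
`∫_{0<t₁<⋯<t_{k+1}<t} ∏ᵢ (tᵢ-tᵢ₋₁)^{-(1-ν)} dt₁⋯dt_{k+1}` (as a Lebesgue integral). -/
noncomputable def simplexIntLFree (ν t : ℝ) (k : ℕ) : ℝ≥0∞ :=
  ∫⁻ v : Fin (k + 1) → ℝ,
    Set.indicator {v : Fin (k + 1) → ℝ | StrictMono v ∧ 0 < v 0 ∧ v (Fin.last k) < t}
      (fun v => ENNReal.ofReal (∏ i, gapR v i ^ (-(1 - ν)))) v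

noncomputable def simplexIntFree (ν t : ℝ) (k : ℕ) : ℝ :=
  (simplexIntLFree ν t k).toReal

/-- The `(k+1)`-fold simplex integral
`∫_{0<t₁<⋯<t_{k+1}<t} t^{1-ν} (t-t_{k+1})^{-(1-ν)} ∏ᵢ (tᵢ-tᵢ₋₁)^{-(1-ν)} dt₁⋯dt_{k+1}`. -/
noncomputable def simplexIntLCons (ν t : ℝ) (k : ℕ) : ℝ≥0∞ :=
  ∫⁻ v : Fin (k + 1) → ℝ,
    Set.indicator {v : Fin (k + 1) → ℝ | StrictMono v ∧ 0 < v 0 ∧ v (Fin.last k) < t}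
      (fun v => ENNReal.ofReal (t ^ (1 - ν) * (t - v (Fin.last k)) ^ (-(1 - ν)) *
        ∏ i, gapR v i ^ (-(1 - ν)))) v

noncomputable def simplexIntCons (ν t : ℝ) (k : ℕ) : ℝ :=
  (simplexIntLCons ν t k).toReal

/-- Continuum free function `Ψ̂^ν_δ̂(t) = 1 + Σ_{k≥1} δ̂^k ∫_{0<t₁<⋯<t_k<t} ∏ (tᵢ-tᵢ₋₁)^{-(1-ν)}`. -/
noncomputable def PsiHatFree (ν d t : ℝ) : ℝ :=
  1 + ∑' k : ℕ, d ^ (k + 1) * simplexIntFree ν t k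

/-- Continuum constrained function `Ψ̂^{ν,c}_δ̂(t)`. -/
noncomputable def PsiHatCons (ν d t : ℝ) : ℝ :=
  1 + ∑' k : ℕ, d ^ (k + 1) * simplexIntCons ν t k

/-- Uniform convergence theorem for slow variation, in additive form. -/
lemma uniform_of_additive_slow {h : ℝ → ℝ} (hm : Measurable h)
    (hs : ∀ u : ℝ, 0 ≤ u → Filter.Tendsto (fun x => h (x + u) - h x) Filter.atTop (nhds 0))
    {L η : ℝ} (hL : 0 ≤ L) (hη : 0 < η) :
    ∃ X : ℝ, ∀ x, X ≤ x → ∀ u, 0 ≤ u → u ≤ L → |h (x + u) - h x| ≤ η := by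
  set φ : ℝ → ℝ := fun r => min |r| 1 with hφ
  have φ_sub : ∀ a b, φ (a - b) ≤ φ a + φ b := by
    intro a b
    have h1 := abs_sub a b
    have h2 := abs_nonneg a
    have h3 := abs_nonneg b
    simp only [hφ]
    rcases le_total |a| 1 with ha | ha <;> rcases le_total |b| 1 with hb | hb <;>
      simp only [ha, hb, min_eq_left, min_eq_right]
    · exact (min_le_left _ _).trans h1
    all_goals exact (min_le_right _ _).trans (by linarith)
  have φ_nonneg : ∀ a, 0 ≤ φ a := fun a => le_min (abs_nonneg a) zero_le_one
  have φ_le : ∀ a, φ a ≤ 1 := fun a => min_le_right _ _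
  have φ_cont : Continuous φ := continuous_abs.min continuous_const
  set F : ℝ → ℝ := fun x => ∫ s in Set.Icc 0 (L + 1), φ (h (x + s) - h x) with hF
  have meas : ∀ x, Measurable (fun s => φ (h (x + s) - h x)) := fun x =>
    φ_cont.measurable.comp ((hm.comp (measurable_const.add measurable_id)).sub_const _)
  have integ : ∀ x (S : Set ℝ), volume S ≠ ⊤ → IntegrableOn (fun s => φ (h (x + s) - h x)) S := by
    intro x S hS
    refine Measure.integrableOn_of_bounded (M := 1) hS (meas x).aestronglyMeasurable ?_
    filter_upwards with s
    rw [Real.norm_eq_abs, abs_of_nonneg (φ_nonneg _)]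
    exact φ_le _
  have F_lim : Filter.Tendsto F Filter.atTop (nhds 0) := by
    have : (0 : ℝ) = ∫ s in Set.Icc 0 (L + 1), (0 : ℝ) := by simp
    rw [this]
    refine tendsto_integral_filter_of_dominated_convergence (fun _ => 1) ?_ ?_ ?_ ?_
    · exact Filter.Eventually.of_forall fun x => (meas x).aestronglyMeasurable
    · refine Filter.Eventually.of_forall fun x => Filter.Eventually.of_forall fun s => ?_
      rw [Real.norm_eq_abs, abs_of_nonneg (φ_nonneg _)]
      exact φ_le _
    · exact integrable_const _
    · filter_upwards [ae_restrict_mem measurableSet_Icc] with s hs'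
      have := (φ_cont.tendsto 0).comp (hs s hs'.1)
      simpa [hφ, Function.comp_def] using this
  set η' := min η (1 / 2) with hη'
  have hη'0 : 0 < η' := lt_min hη (by norm_num)
  obtain ⟨X, hX⟩ := Filter.eventually_atTop.1 (F_lim.eventually_lt_const (half_pos hη'0))
  refine ⟨X, fun x hx u hu huL => ?_⟩
  have key : φ (h (x + u) - h x) ≤ F x + F (x + u) := by
    have e1 : φ (h (x + u) - h x) = ∫ s in Set.Icc L (L + 1), φ (h (x + u) - h x) := by
      simp
    have e2 : ∫ s in Set.Icc L (L + 1), φ (h (x + u) - h x) ≤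
        ∫ s in Set.Icc L (L + 1), (φ (h (x + s) - h x) + φ (h (x + s) - h (x + u))) := by
      refine integral_mono (integrable_const _) ?_ ?_
      · refine (integ x _ (by simp)).add ?_
        refine Measure.integrableOn_of_bounded (M := 1) (by simp) ?_ ?_
        · exact (φ_cont.measurable.comp
            ((hm.comp (measurable_const.add measurable_id)).sub_const _)).aestronglyMeasurable
        · filter_upwards with s
          rw [Real.norm_eq_abs, abs_of_nonneg (φ_nonneg _)]
          exact φ_le _
      · intro s
        have := φ_sub (h (x + s) - h x) (h (x + s) - h (x + u))
        simpa using this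
    have e3 : ∫ s in Set.Icc L (L + 1), φ (h (x + s) - h x) ≤ F x := by
      refine setIntegral_mono_set (integ x _ (by simp)) ?_ ?_
      · exact Filter.Eventually.of_forall fun s => φ_nonneg _
      · exact (Set.Icc_subset_Icc_left hL).eventuallyLE
    have e4 : ∫ s in Set.Icc L (L + 1), φ (h (x + s) - h (x + u)) ≤ F (x + u) := by
      have : ∫ s in Set.Icc L (L + 1), φ (h (x + s) - h (x + u)) =
          ∫ s in Set.Icc (L - u) (L + 1 - u), φ (h (x + u + s) - h (x + u)) := by
        rw [integral_Icc_eq_integral_Ioc, integral_Icc_eq_integral_Ioc,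
          ← intervalIntegral.integral_of_le (by linarith),
          ← intervalIntegral.integral_of_le (by linarith)]
        rw [← intervalIntegral.integral_comp_sub_right
          (fun s => φ (h (x + u + s) - h (x + u))) u]
        congr 1
        ext s
        ring_nf
      rw [this]
      refine setIntegral_mono_set (integ (x + u) _ (by simp)) ?_ ?_
      · exact Filter.Eventually.of_forall fun s => φ_nonneg _
      · exact (Set.Icc_subset_Icc (by linarith) (by linarith)).eventuallyLE
    have e5 : ∫ s in Set.Icc L (L + 1), (φ (h (x + s) - h x) + φ (h (x + s) - h (x + u))) =
        (∫ s in Set.Icc L (L + 1), φ (h (x + s) - h x)) +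
          ∫ s in Set.Icc L (L + 1), φ (h (x + s) - h (x + u)) := by
      refine integral_add (integ x _ (by simp)) ?_
      refine Measure.integrableOn_of_bounded (M := 1) (by simp) ?_ ?_
      · exact (φ_cont.measurable.comp
          ((hm.comp (measurable_const.add measurable_id)).sub_const _)).aestronglyMeasurable
      · filter_upwards with s
        rw [Real.norm_eq_abs, abs_of_nonneg (φ_nonneg _)]
        exact φ_le _
    linarith
  have h1 := hX x hx
  have h2 := hX (x + u) (by linarith)
  have h3 : φ (h (x + u) - h x) < η' := by linarith
  simp only [hφ] at h3
  rcases min_lt_iff.1 h3 with h4 | h4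
  · exact (h4.le).trans (min_le_left _ _)
  · exact absurd h4 (not_lt.2 ((min_le_right _ _).trans (by norm_num)))

/-- A sequence whose increments are asymptotically negligible on geometric windows. -/
def LogSlow (l : ℕ → ℝ) : Prop :=
  ∀ L : ℝ, 1 ≤ L → ∀ η : ℝ, 0 < η → ∃ X : ℕ, 1 ≤ X ∧ ∀ m n : ℕ, X ≤ m → m ≤ n → (n : ℝ) ≤ L * m →
    |l n - l m| ≤ η

lemma logSlow_of_slowlyVarying {ν : ℝ} {M : ℝ → ℝ}
    (hM_pos : ∀ x : ℝ, 0 < x → 0 < M x) (hM_meas : Measurable M)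
    (hM_slow : ∀ c : ℝ, 0 < c →
      Filter.Tendsto (fun x : ℝ => M (c * x) / M x) Filter.atTop (nhds 1))
    {w : ℕ → ℝ} (hw_pos : ∀ n, 0 < w n)
    (hw_asymp : Filter.Tendsto (fun n : ℕ => w n * M n * (n : ℝ) ^ (1 - ν))
      Filter.atTop (nhds 1)) :
    LogSlow (fun n => Real.log (w n * (n : ℝ) ^ (1 - ν))) := by
  intro L hL η hη
  have hm : Measurable fun x => Real.log (M (Real.exp x)) :=
    Real.measurable_log.comp (hM_meas.comp Real.measurable_exp)
  obtain ⟨X, hX⟩ := uniform_of_additive_slow hm (fun u _ => by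
    have h1 := (hM_slow (Real.exp u) (Real.exp_pos u)).comp Real.tendsto_exp_atTop
    have h2 := (Real.continuousAt_log one_ne_zero).tendsto.comp h1
    rw [Real.log_one] at h2
    refine h2.congr fun x => ?_
    have p1 := hM_pos (Real.exp x) (Real.exp_pos x)
    have p2 := hM_pos (Real.exp u * Real.exp x) (by positivity)
    simp only [Function.comp]
    rw [Real.log_div p2.ne' p1.ne', add_comm x u, Real.exp_add])
    (Real.log_nonneg hL) (half_pos hη)
  have hq := (Real.continuousAt_log one_ne_zero).tendsto.comp hw_asymp
  rw [Real.log_one] at hq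
  have hq' := (tendsto_order.1 hq.abs).2 (η / 4) (by simpa using by positivity)
  obtain ⟨Y, hY⟩ := Filter.eventually_atTop.1 hq'
  obtain ⟨Z, hZ⟩ := exists_nat_ge (Real.exp X)
  refine ⟨max 1 (max Y Z), le_max_left _ _, fun m n hm hmn hn => ?_⟩
  have hm1 : 1 ≤ m := (le_max_left _ _).trans hm
  have hmY : Y ≤ m := ((le_max_left _ _).trans (le_max_right _ _)).trans hm
  have hmZ : Z ≤ m := ((le_max_right _ _).trans (le_max_right _ _)).trans hm
  have hm0 : (0 : ℝ) < m := by exact_mod_cast hm1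
  have hmn' : (m : ℝ) ≤ n := by exact_mod_cast hmn
  have hn0 : (0 : ℝ) < n := hm0.trans_le hmn'
  have split : ∀ j : ℕ, (0 : ℝ) < j → Real.log (w j * (j : ℝ) ^ (1 - ν)) =
      Real.log (w j * M j * (j : ℝ) ^ (1 - ν)) - Real.log (M (Real.exp (Real.log j))) := by
    intro j hj
    rw [Real.exp_log hj]
    have := hw_pos j
    have p := hM_pos j hj
    have p2 := Real.rpow_pos_of_pos hj (1 - ν)
    rw [Real.log_mul (by positivity) p2.ne', Real.log_mul (by positivity) p2.ne',
      Real.log_mul this.ne' p.ne']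
    ring
  have k1 := hX (Real.log m) (by
    rw [Real.le_log_iff_exp_le hm0]; exact hZ.trans (by exact_mod_cast hmZ))
    (Real.log n - Real.log m) (by
      have := Real.log_le_log hm0 hmn'
      linarith) (by
      have := Real.log_le_log hn0 hn
      rw [Real.log_mul (by linarith) hm0.ne'] at this
      linarith)
  have k2 := hY m hmY
  have k3 := hY n (hmY.trans hmn)
  simp only [Function.comp] at k2 k3
  simp only
  rw [split m hm0, split n hn0]
  rw [add_sub_cancel] at k1
  rw [abs_le] at k1 ⊢
  rw [abs_lt] at k2 k3
  constructor <;> linarith [k1.1, k1.2, k2.1, k2.2, k3.1, k3.2]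

/-- Potter's bound. -/
lemma LogSlow.potter {l : ℕ → ℝ} (hl : LogSlow l) {ε : ℝ} (hε : 0 < ε) :
    ∃ C : ℝ, 0 ≤ C ∧ ∀ m n : ℕ, 1 ≤ m → m ≤ n → |l n - l m| ≤ ε * Real.log (n / m) + C := by
  have hlog2 : 0 < Real.log 2 := Real.log_pos (by norm_num)
  obtain ⟨X, hX1, hX⟩ := hl 3 (by norm_num) (ε * Real.log 2) (by positivity)
  have big : ∀ n m : ℕ, X ≤ m → m ≤ n → |l n - l m| ≤ ε * Real.log (n / m) + ε * Real.log 2 := by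
    intro n
    induction n using Nat.strong_induction_on with
    | _ n ih =>
    intro m hm hmn
    have hm0 : (0 : ℝ) < m := by exact_mod_cast hX1.trans hm
    have hmn' : (m : ℝ) ≤ n := by exact_mod_cast hmn
    by_cases h3 : n ≤ 3 * m
    · have := hX m n hm hmn (by exact_mod_cast h3)
      have h0 : 0 ≤ Real.log (n / m) := Real.log_nonneg (by rwa [one_le_div hm0])
      nlinarith
    · have k1 := ih (n / 2) (by omega) m hm (by omega)
      have k2 := hX (n / 2) n (by omega) (by omega) (by
        have : n ≤ 3 * (n / 2) := by omega
        exact_mod_cast this)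
      have hh0 : (0 : ℝ) < (n / 2 : ℕ) := by
        have : 0 < n / 2 := by omega
        exact_mod_cast this
      have hh2 : 2 * ((n / 2 : ℕ) : ℝ) ≤ n := by
        have : 2 * (n / 2) ≤ n := by omega
        exact_mod_cast this
      have k3 : Real.log ((n / 2 : ℕ) / m) + Real.log 2 ≤ Real.log (n / m) := by
        rw [← Real.log_mul (by positivity) (by norm_num)]
        apply Real.log_le_log (by positivity)
        rw [div_mul_eq_mul_div]
        gcongr
        linarith
      have k4 := abs_sub_le (l n) (l (n / 2)) (l m)
      nlinarith
  set C0 := ∑ i ∈ Finset.range (X + 1), |l i - l X|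
  have hC0 : 0 ≤ C0 := Finset.sum_nonneg fun i _ => abs_nonneg _
  have corr : ∀ i, |l i - l (max i X)| ≤ C0 := by
    intro i
    rcases le_total i X with h | h
    · rw [max_eq_right h]
      exact Finset.single_le_sum (f := fun i => |l i - l X|) (fun i _ => abs_nonneg _)
        (Finset.mem_range.2 (by omega))
    · rw [max_eq_left h]; simpa using hC0
  refine ⟨2 * C0 + ε * Real.log 2, by positivity, fun m n hm hmn => ?_⟩
  have b := big (max n X) (max m X) (le_max_right _ _) (max_le_max_right _ hmn)
  have hm0 : (0 : ℝ) < m := by exact_mod_cast hm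
  have hX0 : (0 : ℝ) < X := by exact_mod_cast hX1
  have hmn' : (m : ℝ) ≤ n := by exact_mod_cast hmn
  have hn0 : (0 : ℝ) < n := hm0.trans_le hmn'
  have b2 : Real.log ((max n X : ℕ) / (max m X : ℕ)) ≤ Real.log (n / m) := by
    apply Real.log_le_log
    · push_cast; positivity
    · push_cast
      rw [div_le_div_iff₀ (by positivity) hm0]
      rcases le_total (n : ℝ) X with h | h
      · rw [max_eq_right h, max_eq_right (hmn'.trans h)]; nlinarith
      · rw [max_eq_left h]; gcongr; exact le_max_left _ _
  have c1 := corr n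
  have c2 := corr m
  rw [abs_sub_comm] at c2
  have t1 := abs_sub_le (l n) (l (max n X)) (l m)
  have t2 := abs_sub_le (l (max n X)) (l (max m X)) (l m)
  have := mul_le_mul_of_nonneg_left b2 hε.le
  linarith

/-- `convPow w k n` is the `(k+1)`-fold convolution of `w` restricted to positive integers. -/
noncomputable def convPow (w : ℕ → ℝ) : ℕ → ℕ → ℝ
  | 0, n => w n
  | k + 1, n => ∑ m ∈ Finset.Ioo 0 n, convPow w k m * w (n - m)

lemma gapProd_append_pair (w : ℕ → ℝ) (p m n : ℕ) (l : List ℕ) :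
    gapProd w p (l ++ [m, n]) = gapProd w p (l ++ [m]) * w (n - m) := by
  induction l generalizing p with
  | nil => simp [gapProd]
  | cons a l ih => simp [gapProd, ih, mul_assoc]

lemma sum_powersetCard_Ioo_succ (F : Finset ℕ → ℝ) (k n : ℕ) :
    ∑ s ∈ (Finset.Ioo 0 n).powersetCard (k + 1), F s =
      ∑ m ∈ Finset.Ioo 0 n, ∑ s ∈ (Finset.Ioo 0 m).powersetCard k, F (insert m s) := by
  have e0 : Finset.powersetCard (k + 1) (∅ : Finset ℕ) = ∅ :=
    Finset.powersetCard_eq_empty.2 (by simp)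
  induction n with
  | zero => simp [e0]
  | succ n ih =>
    rcases Nat.eq_zero_or_pos n with rfl | hn
    · simp [show Finset.Ioo 0 1 = (∅ : Finset ℕ) from rfl, e0]
    have e : Finset.Ioo 0 (n + 1) = insert n (Finset.Ioo 0 n) := by
      ext; simp; omega
    have hnot : n ∉ Finset.Ioo 0 n := by simp
    rw [e, Finset.powersetCard_succ_insert hnot, Finset.sum_union, ih, Finset.sum_insert hnot,
      add_comm, Finset.sum_image]
    · intro s hs t ht hst
      have hs' : n ∉ s := fun h => hnot ((Finset.mem_powersetCard.1 hs).1 h)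
      have ht' : n ∉ t := fun h => hnot ((Finset.mem_powersetCard.1 ht).1 h)
      rw [← Finset.erase_insert hs', ← Finset.erase_insert ht', hst]
    · rw [Finset.disjoint_left]
      intro s hs hs'
      obtain ⟨t, -, rfl⟩ := Finset.mem_image.1 hs'
      exact hnot ((Finset.mem_powersetCard.1 hs).1 (Finset.mem_insert_self _ _))

lemma sort_insert_of_lt {s : Finset ℕ} {m : ℕ} (h : ∀ x ∈ s, x < m) :
    (insert m s).sort (· ≤ ·) = s.sort (· ≤ ·) ++ [m] := by
  have hm : m ∉ s := fun hm => lt_irrefl _ (h m hm)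
  refine List.Perm.eq_of_pairwise' (r := (· ≤ ·)) (Finset.pairwise_sort _ _) ?_ ?_
  · rw [List.pairwise_append]
    refine ⟨Finset.pairwise_sort _ _, by simp, fun a ha b hb => ?_⟩
    rw [List.mem_singleton.1 hb]
    exact (h a ((Finset.mem_sort _).1 ha)).le
  · refine (List.perm_ext_iff_of_nodup (Finset.sort_nodup _ _) ?_).2 ?_
    · rw [List.nodup_append]
      refine ⟨Finset.sort_nodup _ _, by simp, fun a ha b hb hab => ?_⟩
      rw [List.mem_singleton.1 hb] at hab
      exact hm (hab ▸ (Finset.mem_sort _).1 ha)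
    · intro a
      simp [or_comm]

lemma sum_gapProd_eq_convPow (w : ℕ → ℝ) (k n : ℕ) :
    ∑ s ∈ (Finset.Ioo 0 n).powersetCard k, gapProd w 0 (s.sort (· ≤ ·) ++ [n]) =
      convPow w k n := by
  induction k generalizing n with
  | zero => simp [gapProd, convPow]
  | succ k ih =>
    rw [sum_powersetCard_Ioo_succ, convPow]
    refine Finset.sum_congr rfl fun m _ => ?_
    rw [← ih, Finset.sum_mul]
    refine Finset.sum_congr rfl fun s hs => ?_
    rw [sort_insert_of_lt fun x hx =>
      (Finset.mem_Ioo.1 ((Finset.mem_powersetCard.1 hs).1 hx)).2, List.append_assoc,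
      ← gapProd_append_pair]
    rfl

lemma convPow_eq_zero (w : ℕ → ℝ) {k n : ℕ} (hk : k ≠ 0) (h : n ≤ k) : convPow w k n = 0 := by
  induction k generalizing n with
  | zero => simp at hk
  | succ k ih =>
    rw [convPow]
    refine Finset.sum_eq_zero fun m hm => ?_
    rw [Finset.mem_Ioo] at hm
    rw [ih (by omega) (by omega), zero_mul]

lemma convPow_nonneg {w : ℕ → ℝ} (hw : ∀ n, 0 < w n) (k n : ℕ) : 0 ≤ convPow w k n := by
  induction k generalizing n with
  | zero => exact (hw n).le
  | succ k ih => exact Finset.sum_nonneg fun m _ => mul_nonneg (ih m) (hw _).le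

lemma PsiCons_eq_tsum {w : ℕ → ℝ} (hw : ∀ n, 0 < w n) (d : ℝ) {n : ℕ} (hn : 1 ≤ n) :
    PsiCons w d n = ∑' k : ℕ, (Real.exp d - 1) ^ k * (convPow w k n / w n) := by
  rw [tsum_eq_sum (s := Finset.range n) fun k hk => by
    simp only [Finset.mem_range, not_lt] at hk
    rw [convPow_eq_zero w (by omega) hk]
    simp]
  obtain ⟨n, rfl⟩ := Nat.exists_eq_add_of_le' hn
  rw [Finset.sum_range_succ', PsiCons, add_comm]
  congr 1
  · rw [Finset.range_eq_Ico, Finset.sum_Ico_add' (fun k => (Real.exp d - 1) ^ k *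
      (convPow w k (n + 1) / w (n + 1))) 0 n 1]
    refine Finset.sum_congr ?_ fun k _ => ?_
    · ext; simp
    · rw [← sum_gapProd_eq_convPow, Finset.sum_div]
  · simp [convPow, (hw (n + 1)).ne']

/-- `gFun w k n` is the `k`-point constrained sum normalised by `(n w(n))^k`. -/
noncomputable def gFun (w : ℕ → ℝ) (k n : ℕ) : ℝ := convPow w k n / w n / (n * w n) ^ k

lemma PsiCons_eq_tsum_gFun {w : ℕ → ℝ} (hw : ∀ n, 0 < w n) (d : ℝ) {n : ℕ} (hn : 1 ≤ n) :
    PsiCons w d n = ∑' k : ℕ, gFun w k n * ((Real.exp d - 1) * (n * w n)) ^ k := by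
  rw [PsiCons_eq_tsum hw d hn]
  refine tsum_congr fun k => ?_
  have hn' : (0 : ℝ) < n := by exact_mod_cast hn
  have := hw n
  have hP : ((n : ℝ) * w n) ^ k ≠ 0 := by positivity
  rw [gFun, mul_pow (Real.exp d - 1)]
  generalize ((n : ℝ) * w n) ^ k = P at hP
  field_simp

lemma gFun_nonneg {w : ℕ → ℝ} (hw : ∀ n, 0 < w n) (k n : ℕ) : 0 ≤ gFun w k n := by
  have := hw n
  have := convPow_nonneg hw k n
  unfold gFun
  positivity

/-- The Beta integral. -/
noncomputable def betaI (a b : ℝ) : ℝ := ∫ s in Set.Ioo (0 : ℝ) 1, s ^ (a - 1) * (1 - s) ^ (b - 1)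

lemma integrableOn_beta {a b : ℝ} (ha : 0 < a) (hb : 0 < b) :
    IntegrableOn (fun s : ℝ => s ^ (a - 1) * (1 - s) ^ (b - 1)) (Set.Ioo 0 1) := by
  have h := Complex.betaIntegral_convergent (u := a) (v := b) (by simpa) (by simpa)
  rw [intervalIntegrable_iff_integrableOn_Ioo_of_le zero_le_one] at h
  refine IntegrableOn.congr_fun h.norm (fun s hs => ?_) measurableSet_Ioo
  have h1 : 0 < 1 - s := by linarith [hs.2]
  rw [norm_mul]
  have e : (1 - (s : ℂ)) = ((1 - s : ℝ) : ℂ) := by push_cast; rfl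
  rw [e, Complex.norm_cpow_eq_rpow_re_of_pos hs.1, Complex.norm_cpow_eq_rpow_re_of_pos h1]
  simp

lemma betaI_nonneg (a b : ℝ) : 0 ≤ betaI a b :=
  setIntegral_nonneg measurableSet_Ioo fun s hs =>
    mul_nonneg (Real.rpow_nonneg hs.1.le _) (Real.rpow_nonneg (by linarith [hs.2]) _)

lemma tendsto_betaI {ν : ℝ} (hν : 0 < ν) :
    Filter.Tendsto (fun k : ℕ => betaI ((k + 1) * ν) ν) Filter.atTop (nhds 0) := by
  unfold betaI
  rw [show nhds (0 : ℝ) = nhds (∫ s in Set.Ioo (0 : ℝ) 1, (0 : ℝ)) by simp]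
  refine tendsto_integral_of_dominated_convergence (G := ℝ)
    (fun s : ℝ => s ^ (ν - 1) * (1 - s) ^ (ν - 1)) ?_ (integrableOn_beta hν hν) ?_ ?_
  · intro k
    exact (integrableOn_beta (by positivity) hν).aestronglyMeasurable
  · intro k
    filter_upwards [ae_restrict_mem measurableSet_Ioo] with s hs
    have h1 : 0 < 1 - s := by linarith [hs.2]
    have := hs.1
    rw [Real.norm_of_nonneg (by positivity)]
    gcongr ?_ * _
    apply Real.rpow_le_rpow_of_exponent_ge hs.1 hs.2.le
    have : (0 : ℝ) ≤ k := by positivity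
    nlinarith
  · filter_upwards [ae_restrict_mem measurableSet_Ioo] with s hs
    have h1 : 0 < 1 - s := by linarith [hs.2]
    have hlim : Filter.Tendsto (fun k : ℕ => (s ^ ν) ^ k * (s ^ (ν - 1) * (1 - s) ^ (ν - 1)))
        Filter.atTop (nhds (0 * (s ^ (ν - 1) * (1 - s) ^ (ν - 1)))) :=
      (tendsto_pow_atTop_nhds_zero_of_lt_one (Real.rpow_nonneg hs.1.le _)
        (Real.rpow_lt_one hs.1.le hs.2 hν)).mul_const _
    rw [zero_mul] at hlim
    refine hlim.congr fun k => ?_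
    rw [← mul_assoc]
    congr 1
    rw [← Real.rpow_natCast, ← Real.rpow_mul hs.1.le, ← Real.rpow_add hs.1]
    ring_nf

/-- The Riemann sum of a function of `⌊n s⌋`. -/
lemma integral_floor {Φ : ℕ → ℝ} {n : ℕ} (hn : 0 < n) :
    IntegrableOn (fun s : ℝ => Φ ⌊n * s⌋₊) (Set.Ioo 0 1) ∧
      ∫ s in Set.Ioo (0 : ℝ) 1, Φ ⌊n * s⌋₊ = (∑ m ∈ Finset.range n, Φ m) / n := by
  have hn0 : (0 : ℝ) < n := by exact_mod_cast hn
  have hfl : ∀ m : ℕ, ∀ s ∈ Set.Ioo ((m : ℝ) / n) ((m + 1 : ℕ) / n), Φ m = Φ ⌊n * s⌋₊ := by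
    intro m s hs
    congr 1
    symm
    rw [Nat.floor_eq_iff]
    · rw [Set.mem_Ioo, div_lt_iff₀ hn0, lt_div_iff₀ hn0] at hs
      push_cast at hs
      constructor <;> linarith [hs.1, hs.2]
    · have : 0 ≤ (m : ℝ) / n := by positivity
      have := hs.1
      have : 0 < s := by linarith
      positivity
  have hle : ∀ m : ℕ, (m : ℝ) / n ≤ (m + 1 : ℕ) / n := fun m => by gcongr; simp
  have hii : ∀ m : ℕ, IntervalIntegrable (fun s : ℝ => Φ ⌊n * s⌋₊) volume
      ((m : ℝ) / n) ((m + 1 : ℕ) / n) := by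
    intro m
    rw [intervalIntegrable_iff_integrableOn_Ioo_of_le (hle m)]
    exact IntegrableOn.congr_fun (integrableOn_const (by simp)) (hfl m) measurableSet_Ioo
  have hval : ∀ m : ℕ, ∫ s in ((m : ℝ) / n)..((m + 1 : ℕ) / n), Φ ⌊n * s⌋₊ = Φ m / n := by
    intro m
    rw [intervalIntegral.integral_of_le (hle m), integral_Ioc_eq_integral_Ioo,
      ← setIntegral_congr_fun measurableSet_Ioo (hfl m)]
    simp only [setIntegral_const, Measure.real, Real.volume_Ioo, smul_eq_mul]
    rw [ENNReal.toReal_ofReal (by linarith [hle m])]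
    push_cast
    ring
  have h01 : ((0 : ℕ) : ℝ) / n = 0 := by simp
  have h11 : ((n : ℕ) : ℝ) / n = 1 := div_self hn0.ne'
  constructor
  · have := IntervalIntegrable.trans_iterate (n := n) (a := fun m : ℕ => (m : ℝ) / n)
      (f := fun s : ℝ => Φ ⌊n * s⌋₊) (μ := volume) fun m _ => hii m
    simp only [h01, h11] at this
    rwa [intervalIntegrable_iff_integrableOn_Ioo_of_le zero_le_one] at this
  · have := intervalIntegral.sum_integral_adjacent_intervals (n := n)
      (a := fun m : ℕ => (m : ℝ) / n)
      (f := fun s : ℝ => Φ ⌊n * s⌋₊) (μ := volume) fun m _ => hii m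
    simp only [h01, h11] at this
    rw [← integral_Ioc_eq_integral_Ioo, ← intervalIntegral.integral_of_le zero_le_one, ← this,
      Finset.sum_div]
    exact Finset.sum_congr rfl fun m _ => hval m

lemma rpow_floor_le {a s : ℝ} {n : ℕ} (ha : 0 < a) (hs0 : 0 < s) (hm : ⌊n * s⌋₊ ≠ 0) :
    (⌊n * s⌋₊ : ℝ) ^ (a - 1) ≤ 2 * (n * s) ^ (a - 1) := by
  have hm1 : (1 : ℝ) ≤ (⌊n * s⌋₊ : ℝ) := by exact_mod_cast Nat.one_le_iff_ne_zero.2 hm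
  have h1 : (⌊n * s⌋₊ : ℝ) ≤ n * s := Nat.floor_le (by positivity)
  have h2 : n * s < (⌊n * s⌋₊ : ℝ) + 1 := Nat.lt_floor_add_one _
  have hns : 0 < n * s := by linarith
  rcases le_total 1 a with h | h
  · have := Real.rpow_le_rpow (by positivity) h1 (by linarith : 0 ≤ a - 1)
    have p := Real.rpow_nonneg hns.le (a - 1)
    linarith
  · calc (⌊n * s⌋₊ : ℝ) ^ (a - 1) ≤ (n * s / 2) ^ (a - 1) :=
          Real.rpow_le_rpow_of_nonpos (by positivity) (by linarith) (by linarith)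
      _ = (1 / 2 : ℝ) ^ (a - 1) * (n * s) ^ (a - 1) := by
          rw [← Real.mul_rpow (by norm_num) hns.le]; ring_nf
      _ ≤ 2 * (n * s) ^ (a - 1) := by
          gcongr
          rw [one_div, Real.inv_rpow (by norm_num), ← Real.rpow_neg (by norm_num)]
          calc (2 : ℝ) ^ (-(a - 1)) ≤ 2 ^ (1 : ℝ) :=
                Real.rpow_le_rpow_of_exponent_le (by norm_num) (by linarith)
            _ = 2 := Real.rpow_one 2

lemma rpow_sub_floor_le {b s : ℝ} {n : ℕ} (hb : b ≤ 1) (hn : 0 < n) (hs0 : 0 < s) (hs1 : s < 1) :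
    ((n : ℝ) - ⌊n * s⌋₊) ^ (b - 1) ≤ (n * (1 - s)) ^ (b - 1) := by
  have hn0 : (0 : ℝ) < n := by exact_mod_cast hn
  have h1 : (⌊n * s⌋₊ : ℝ) ≤ n * s := Nat.floor_le (by positivity)
  have : 0 < 1 - s := by linarith
  exact Real.rpow_le_rpow_of_nonpos (by positivity) (by linarith) (by linarith)

lemma floor_mul_lt {s : ℝ} {n : ℕ} (hn : 0 < n) (hs1 : s < 1) : ⌊n * s⌋₊ < n := by
  have hn0 : (0 : ℝ) < n := by exact_mod_cast hn
  rcases le_total 0 s with h | h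
  · rw [Nat.floor_lt (by positivity)]; nlinarith
  · rwa [Nat.floor_of_nonpos (by nlinarith)]

lemma sum_Ioo_eq_sum_range {n : ℕ} (hn : 0 < n) (Φ : ℕ → ℝ) :
    ∑ m ∈ Finset.Ioo 0 n, Φ m = ∑ m ∈ Finset.range n, if m = 0 then 0 else Φ m := by
  obtain ⟨n, rfl⟩ := Nat.exists_eq_add_of_le' hn
  have e : Finset.range (n + 1) = insert 0 (Finset.Ioo 0 (n + 1)) := by
    ext; simp
  rw [e, Finset.sum_insert (by simp), if_pos rfl, zero_add]
  exact Finset.sum_congr rfl fun m hm => (if_neg (by simp at hm; omega)).symm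

lemma sum_rpow_mul_rpow_le {a b : ℝ} (ha : 0 < a) (hb : 0 < b) (hb1 : b ≤ 1) {n : ℕ} (hn : 0 < n) :
    ∑ m ∈ Finset.Ioo 0 n, (m : ℝ) ^ (a - 1) * ((n - m : ℕ) : ℝ) ^ (b - 1) ≤
      2 * betaI a b * (n : ℝ) ^ (a + b - 1) := by
  have hn0 : (0 : ℝ) < n := by exact_mod_cast hn
  set Φ : ℕ → ℝ := fun m => if m = 0 then 0 else (m : ℝ) ^ (a - 1) * ((n - m : ℕ) : ℝ) ^ (b - 1)
    with hΦ
  obtain ⟨h1, h2⟩ := integral_floor (Φ := Φ) hn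
  rw [sum_Ioo_eq_sum_range hn]
  have h3 : ∑ m ∈ Finset.range n, Φ m = n * ∫ s in Set.Ioo (0 : ℝ) 1, Φ ⌊n * s⌋₊ := by
    rw [h2]; field_simp
  change ∑ m ∈ Finset.range n, Φ m ≤ _
  rw [h3]
  have h4 : ∫ s in Set.Ioo (0 : ℝ) 1, Φ ⌊n * s⌋₊ ≤ ∫ s in Set.Ioo (0 : ℝ) 1,
      2 * (n : ℝ) ^ (a + b - 2) * (s ^ (a - 1) * (1 - s) ^ (b - 1)) := by
    refine setIntegral_mono_on h1 ((integrableOn_beta ha hb).const_mul _) measurableSet_Ioo ?_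
    intro s hs
    have hs1 : 0 < 1 - s := by linarith [hs.2]
    have := hs.1
    by_cases hm : ⌊n * s⌋₊ = 0
    · simp only [hΦ, hm, if_true]
      positivity
    · simp only [hΦ, if_neg hm]
      rw [Nat.cast_sub (floor_mul_lt hn hs.2).le]
      calc (⌊n * s⌋₊ : ℝ) ^ (a - 1) * ((n : ℝ) - ⌊n * s⌋₊) ^ (b - 1)
          ≤ (2 * (n * s) ^ (a - 1)) * (n * (1 - s)) ^ (b - 1) := by
            refine mul_le_mul (rpow_floor_le ha hs.1 hm) (rpow_sub_floor_le hb1 hn hs.1 hs.2)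
              (Real.rpow_nonneg ?_ _) (by positivity)
            have : (⌊n * s⌋₊ : ℝ) ≤ n := by exact_mod_cast (floor_mul_lt hn hs.2).le
            linarith
        _ = _ := by
            rw [Real.mul_rpow hn0.le hs.1.le, Real.mul_rpow hn0.le hs1.le,
              show a + b - 2 = (a - 1) + (b - 1) by ring, Real.rpow_add hn0]
            ring
  rw [integral_const_mul] at h4
  calc n * ∫ s in Set.Ioo (0 : ℝ) 1, Φ ⌊n * s⌋₊
      ≤ n * (2 * (n : ℝ) ^ (a + b - 2) * betaI a b) := by gcongr; exact h4
    _ = _ := by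
      rw [show a + b - 1 = (a + b - 2) + 1 by ring, Real.rpow_add_one hn0.ne']
      ring

lemma lintegral_beta_scaled {a b t : ℝ} (ha : 0 < a) (hb : 0 < b) (ht : 0 < t) :
    ∫⁻ s in Set.Ioo 0 t, ENNReal.ofReal (s ^ (a - 1) * (t - s) ^ (b - 1)) =
      ENNReal.ofReal (betaI a b * t ^ (a + b - 1)) := by
  have hi := integrableOn_beta ha hb
  rw [← intervalIntegrable_iff_integrableOn_Ioo_of_le zero_le_one] at hi
  have hi' := (hi.comp_mul_left (c := t⁻¹)).const_mul (t ^ (a + b - 2))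
  rw [zero_div, div_inv_eq_mul, one_mul,
    intervalIntegrable_iff_integrableOn_Ioo_of_le ht.le] at hi'
  have hpt : ∀ s ∈ Set.Ioo 0 t, t ^ (a + b - 2) * ((t⁻¹ * s) ^ (a - 1) * (1 - t⁻¹ * s) ^ (b - 1)) =
      s ^ (a - 1) * (t - s) ^ (b - 1) := by
    intro s hs
    have h1 : 0 < t⁻¹ * s := mul_pos (by positivity) hs.1
    have h2 : 0 < 1 - t⁻¹ * s := by
      rw [sub_pos, inv_mul_lt_iff₀ ht]; linarith [hs.2]
    rw [show a + b - 2 = (a - 1) + (b - 1) by ring, Real.rpow_add ht, mul_mul_mul_comm,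
      ← Real.mul_rpow ht.le h1.le, ← Real.mul_rpow ht.le h2.le]
    congr 2 <;> field_simp
  have hi2 := hi'.congr_fun hpt measurableSet_Ioo
  rw [← ofReal_integral_eq_lintegral_ofReal hi2]
  · congr 1
    rw [← setIntegral_congr_fun measurableSet_Ioo hpt, integral_const_mul,
      ← integral_Ioc_eq_integral_Ioo, ← intervalIntegral.integral_of_le ht.le,
      intervalIntegral.integral_comp_mul_left (fun s => s ^ (a - 1) * (1 - s) ^ (b - 1))
        (inv_ne_zero ht.ne'), mul_zero, inv_mul_cancel₀ ht.ne', inv_inv, betaI,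
      ← integral_Ioc_eq_integral_Ioo, ← intervalIntegral.integral_of_le zero_le_one,
      show a + b - 1 = (a + b - 2) + 1 by ring, Real.rpow_add_one ht.ne', smul_eq_mul]
    ring
  · filter_upwards [ae_restrict_mem measurableSet_Ioo] with s hs
    have h1 : 0 < t - s := by linarith [hs.2]
    have := hs.1
    positivity

/-- The coefficients of the limiting power series. -/
noncomputable def cCoef (ν : ℝ) : ℕ → ℝ
  | 0 => 1
  | k + 1 => cCoef ν k * betaI ((k + 1) * ν) ν

lemma cCoef_nonneg (ν : ℝ) (k : ℕ) : 0 ≤ cCoef ν k := by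
  induction k with
  | zero => simp [cCoef]
  | succ k ih => exact mul_nonneg ih (betaI_nonneg _ _)

lemma measurable_gapR {k : ℕ} (i : Fin k) : Measurable fun v : Fin k → ℝ => gapR v i := by
  unfold gapR
  split_ifs <;> fun_prop

lemma measurableSet_simplex (k : ℕ) (t : ℝ) : MeasurableSet
    {v : Fin (k + 1) → ℝ | StrictMono v ∧ 0 < v 0 ∧ v (Fin.last k) < t} := by
  refine MeasurableSet.inter ?_ (MeasurableSet.inter ?_ ?_)
  · have e : {v : Fin (k + 1) → ℝ | StrictMono v} =
        ⋂ i : Fin k, {v : Fin (k + 1) → ℝ | v i.castSucc < v i.succ} := by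
      ext v
      simp [Fin.strictMono_iff_lt_succ]
    change MeasurableSet {v : Fin (k + 1) → ℝ | StrictMono v}
    rw [e]
    exact MeasurableSet.iInter fun i =>
      measurableSet_lt (measurable_pi_apply _) (measurable_pi_apply _)
  · exact measurableSet_lt measurable_const (measurable_pi_apply _)
  · exact measurableSet_lt (measurable_pi_apply _) measurable_const

/-- The simplex integral without its normalising prefactor. -/
noncomputable def simplexKer (ν t : ℝ) (k : ℕ) (v : Fin (k + 1) → ℝ) : ℝ≥0∞ :=
  Set.indicator {v : Fin (k + 1) → ℝ | StrictMono v ∧ 0 < v 0 ∧ v (Fin.last k) < t}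
      (fun v => ENNReal.ofReal ((t - v (Fin.last k)) ^ (-(1 - ν)) *
        ∏ i, gapR v i ^ (-(1 - ν)))) v

lemma measurable_simplexKer (ν t : ℝ) (k : ℕ) : Measurable (simplexKer ν t k) := by
  refine Measurable.indicator ?_ (measurableSet_simplex k t)
  refine ENNReal.measurable_ofReal.comp (Measurable.mul ?_ ?_)
  · fun_prop
  · exact Finset.measurable_prod _ fun i _ => (measurable_gapR i).pow_const _

lemma gapR_snoc_castSucc {k : ℕ} (u : Fin k → ℝ) (s : ℝ) (i : Fin k) :
    gapR (Fin.snoc (α := fun _ => ℝ) u s) i.castSucc = gapR u i := by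
  unfold gapR
  rw [Fin.snoc_castSucc]
  simp only [Fin.val_castSucc]
  split_ifs with h
  · rfl
  · have e : (⟨(i : ℕ) - 1, by omega⟩ : Fin (k + 1)) =
        Fin.castSucc ⟨(i : ℕ) - 1, by omega⟩ := rfl
    rw [e, Fin.snoc_castSucc]

lemma gapR_snoc_last {k : ℕ} (u : Fin (k + 1) → ℝ) (s : ℝ) :
    gapR (Fin.snoc (α := fun _ => ℝ) u s) (Fin.last (k + 1)) = s - u (Fin.last k) := by
  unfold gapR
  rw [Fin.snoc_last]
  have e : (⟨((Fin.last (k + 1) : Fin (k + 2)) : ℕ) - 1, by simp⟩ : Fin (k + 2)) =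
      Fin.castSucc (Fin.last k) := by ext; simp
  rw [dif_neg (by simp), e, Fin.snoc_castSucc]

lemma snoc_mem_simplex_iff {k : ℕ} (u : Fin (k + 1) → ℝ) (s t : ℝ) :
    (StrictMono (Fin.snoc (α := fun _ => ℝ) u s) ∧
      0 < (Fin.snoc (α := fun _ => ℝ) u s : Fin (k + 2) → ℝ) 0 ∧
      (Fin.snoc (α := fun _ => ℝ) u s : Fin (k + 2) → ℝ) (Fin.last (k + 1)) < t) ↔
    (StrictMono u ∧ 0 < u 0 ∧ u (Fin.last k) < s) ∧ s ∈ Set.Ioo 0 t := by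
  have e0 : (Fin.snoc (α := fun _ => ℝ) u s : Fin (k + 2) → ℝ) 0 = u 0 :=
    Fin.snoc_castSucc (α := fun _ => ℝ) s u 0
  have hm : StrictMono (Fin.snoc (α := fun _ => ℝ) u s : Fin (k + 2) → ℝ) ↔
      StrictMono u ∧ u (Fin.last k) < s := by
    rw [Fin.strictMono_iff_lt_succ, Fin.strictMono_iff_lt_succ, Fin.forall_fin_succ']
    have e1 : ∀ i : Fin k, (Fin.snoc (α := fun _ => ℝ) u s : Fin (k + 2) → ℝ) i.castSucc.succ =
        u i.succ := fun i => by rw [← Fin.castSucc_succ, Fin.snoc_castSucc]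
    simp only [Fin.snoc_castSucc, Fin.succ_last, Fin.snoc_last, e1]
  rw [e0, hm, Fin.snoc_last, Set.mem_Ioo]
  constructor
  · rintro ⟨⟨h1, h2⟩, h3, h4⟩
    exact ⟨⟨h1, h3, h2⟩, h3.trans_le ((h1.monotone (Fin.zero_le _)).trans h2.le), h4⟩
  · rintro ⟨⟨h1, h2, h3⟩, h4, h5⟩
    exact ⟨⟨h1, h3⟩, h2, h5⟩

lemma simplexKer_snoc (ν t : ℝ) {k : ℕ} (u : Fin (k + 1) → ℝ) (s : ℝ) :
    simplexKer ν t (k + 1) (Fin.snoc (α := fun _ => ℝ) u s) =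
      Set.indicator (Set.Ioo 0 t) (fun s => ENNReal.ofReal ((t - s) ^ (-(1 - ν)))) s *
        simplexKer ν s k u := by
  unfold simplexKer
  simp only [Set.indicator_apply, Set.mem_ofPred_eq, snoc_mem_simplex_iff]
  by_cases hs : s ∈ Set.Ioo 0 t
  · by_cases hu : StrictMono u ∧ 0 < u 0 ∧ u (Fin.last k) < s
    · rw [if_pos ⟨hu, hs⟩, if_pos hs, if_pos hu, ← ENNReal.ofReal_mul
        (Real.rpow_nonneg (by linarith [hs.2]) _), Fin.prod_univ_castSucc]
      simp only [gapR_snoc_castSucc, gapR_snoc_last, Fin.snoc_last]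
      congr 1
      ring
    · rw [if_neg fun h => hu h.1, if_neg hu, mul_zero]
  · rw [if_neg fun h => hs h.2, if_neg hs, zero_mul]

lemma lintegral_simplexKer_succ (ν t : ℝ) (k : ℕ) :
    ∫⁻ v, simplexKer ν t (k + 1) v =
      ∫⁻ s in Set.Ioo 0 t, ENNReal.ofReal ((t - s) ^ (-(1 - ν))) * ∫⁻ u, simplexKer ν s k u := by
  have hp := (volume_preserving_piFinSuccAbove (fun _ : Fin (k + 2) => ℝ) (Fin.last (k + 1))).symm
  rw [← hp.lintegral_comp (measurable_simplexKer ν t (k + 1)), Measure.volume_eq_prod,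
    lintegral_prod (fun z => simplexKer ν t (k + 1)
      ((MeasurableEquiv.piFinSuccAbove (fun _ : Fin (k + 2) => ℝ) (Fin.last (k + 1))).symm z))
      ((measurable_simplexKer ν t (k + 1)).comp hp.measurable).aemeasurable,
    ← lintegral_indicator measurableSet_Ioo]
  refine lintegral_congr fun s => ?_
  have e : ∀ u : Fin (k + 1) → ℝ,
      (MeasurableEquiv.piFinSuccAbove (fun _ : Fin (k + 2) => ℝ) (Fin.last (k + 1))).symm (s, u) =
        Fin.snoc (α := fun _ => ℝ) u s := fun u =>
    Fin.insertNth_last' s u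
  simp only [e, simplexKer_snoc]
  rw [lintegral_const_mul _ (measurable_simplexKer ν s k)]
  by_cases hs : s ∈ Set.Ioo 0 t
  · simp only [Set.indicator_of_mem hs]
  · simp only [Set.indicator_of_notMem hs, zero_mul]

lemma lintegral_simplexKer {ν : ℝ} (hν : 0 < ν) {t : ℝ} (ht : 0 < t) (k : ℕ) :
    ∫⁻ v, simplexKer ν t k v = ENNReal.ofReal (cCoef ν (k + 1) * t ^ ((k + 2) * ν - 1)) := by
  induction k generalizing t with
  | zero =>
    have hp := (volume_preserving_funUnique (Fin 1) ℝ).symm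
    refine (hp.lintegral_comp (measurable_simplexKer ν t 0)).symm.trans ?_
    have h := lintegral_beta_scaled hν hν ht
    rw [← lintegral_indicator measurableSet_Ioo] at h
    calc _ = _ := ?_
      _ = _ := h
      _ = _ := by simp [cCoef]; ring_nf
    refine lintegral_congr fun s => ?_
    have hs0 : ∀ i, (MeasurableEquiv.funUnique (Fin 1) ℝ).symm s i = s := fun i => rfl
    unfold simplexKer
    simp only [Set.indicator_apply, Set.mem_ofPred_eq, hs0, Set.mem_Ioo]
    have hsm : StrictMono ((MeasurableEquiv.funUnique (Fin 1) ℝ).symm s) :=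
      Subsingleton.strictMono _
    simp only [hsm, true_and]
    refine if_congr Iff.rfl ?_ rfl
    simp [gapR, hs0, mul_comm]
  | succ k ih =>
    rw [lintegral_simplexKer_succ]
    have h := lintegral_beta_scaled (a := (k + 2) * ν) (by positivity) hν ht
    have hc := cCoef_nonneg ν (k + 1)
    calc _ = ∫⁻ s in Set.Ioo 0 t, ENNReal.ofReal (cCoef ν (k + 1)) *
          ENNReal.ofReal (s ^ ((k + 2) * ν - 1) * (t - s) ^ (ν - 1)) := by
          refine setLIntegral_congr_fun measurableSet_Ioo fun s hs => ?_
          have h1 : 0 < t - s := by linarith [hs.2]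
          rw [ih hs.1, ← ENNReal.ofReal_mul (by positivity), ← ENNReal.ofReal_mul hc]
          congr 1
          rw [neg_sub]; ring
      _ = _ := by
          rw [lintegral_const_mul' _ _ ENNReal.ofReal_ne_top, h, ← ENNReal.ofReal_mul hc,
            show cCoef ν (k + 1 + 1) = cCoef ν (k + 1) * betaI (((k + 1 : ℕ) + 1) * ν) ν from rfl]
          push_cast
          rw [show (k : ℝ) + 1 + 1 = k + 2 by ring, mul_assoc]
          ring_nf

lemma simplexIntLCons_eq {ν : ℝ} (hν : ν ∈ Set.Ioo (0 : ℝ) 1) {t : ℝ} (ht : 0 ≤ t) (k : ℕ) :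
    simplexIntLCons ν t k = ENNReal.ofReal (cCoef ν (k + 1) * (t ^ ν) ^ (k + 1)) := by
  have e : simplexIntLCons ν t k = ∫⁻ v, ENNReal.ofReal (t ^ (1 - ν)) * simplexKer ν t k v := by
    refine lintegral_congr fun v => ?_
    unfold simplexKer
    simp only [Set.indicator_apply]
    split_ifs
    · rw [← ENNReal.ofReal_mul (by positivity), mul_assoc]
    · simp
  rw [e, lintegral_const_mul' _ _ ENNReal.ofReal_ne_top]
  rcases ht.eq_or_lt with rfl | ht
  · rw [Real.zero_rpow (by linarith [hν.2]), Real.zero_rpow hν.1.ne']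
    simp
  · rw [lintegral_simplexKer hν.1 ht, ← ENNReal.ofReal_mul (by positivity)]
    congr 1
    rw [mul_left_comm, ← Real.rpow_add ht, ← Real.rpow_natCast, ← Real.rpow_mul ht.le]
    push_cast
    ring_nf

lemma simplexIntCons_eq {ν : ℝ} (hν : ν ∈ Set.Ioo (0 : ℝ) 1) {t : ℝ} (ht : 0 ≤ t) (k : ℕ) :
    simplexIntCons ν t k = cCoef ν (k + 1) * (t ^ ν) ^ (k + 1) := by
  have := cCoef_nonneg ν (k + 1)
  rw [simplexIntCons, simplexIntLCons_eq hν ht, ENNReal.toReal_ofReal (by positivity)]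

lemma summable_cCoef {ν : ℝ} (hν : 0 < ν) (x : ℝ) : Summable fun k => cCoef ν k * x ^ k := by
  have h := ((tendsto_betaI hν).mul_const |x|)
  rw [zero_mul] at h
  refine summable_of_ratio_norm_eventually_le (r := 1 / 2) (by norm_num) ?_
  filter_upwards [(tendsto_order.1 h).2 (1 / 2) (by norm_num)] with k hk
  rw [cCoef, norm_mul, norm_mul, norm_mul, norm_pow, norm_pow, pow_succ, Real.norm_eq_abs x,
    Real.norm_of_nonneg (betaI_nonneg _ _)]
  calc _ = (betaI ((k + 1) * ν) ν * |x|) * (‖cCoef ν k‖ * |x| ^ k) := by ring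
    _ ≤ _ := by gcongr

lemma convPow_le {w : ℕ → ℝ} (hw : ∀ n, 0 < w n) {ρ P : ℝ} (hρ : 0 < ρ) (hρ1 : ρ ≤ 1)
    (hP : 0 ≤ P) {K : ℕ} (h : ∀ m, 1 ≤ m → m ≤ K → w m ≤ P * (m : ℝ) ^ (ρ - 1)) (k : ℕ) {m : ℕ}
    (hm : 1 ≤ m) (hmK : m ≤ K) :
    convPow w k m ≤ P ^ (k + 1) * 2 ^ k * cCoef ρ k * (m : ℝ) ^ ((k + 1) * ρ - 1) := by
  induction k generalizing m with
  | zero => simpa [convPow, cCoef] using h m hm hmK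
  | succ k ih =>
    have hc := cCoef_nonneg ρ k
    calc convPow w (k + 1) m
        ≤ ∑ i ∈ Finset.Ioo 0 m, (P ^ (k + 1) * 2 ^ k * cCoef ρ k * (i : ℝ) ^ ((k + 1) * ρ - 1)) *
            (P * ((m - i : ℕ) : ℝ) ^ (ρ - 1)) := by
          refine Finset.sum_le_sum fun i hi => ?_
          rw [Finset.mem_Ioo] at hi
          exact mul_le_mul (ih (by omega) (by omega)) (h _ (by omega) (by omega)) (hw _).le
            (by positivity)
      _ = P ^ (k + 2) * 2 ^ k * cCoef ρ k * ∑ i ∈ Finset.Ioo 0 m,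
            (i : ℝ) ^ ((k + 1) * ρ - 1) * ((m - i : ℕ) : ℝ) ^ (ρ - 1) := by
          rw [Finset.mul_sum]
          refine Finset.sum_congr rfl fun i _ => ?_
          ring
      _ ≤ P ^ (k + 2) * 2 ^ k * cCoef ρ k *
            (2 * betaI ((k + 1) * ρ) ρ * (m : ℝ) ^ ((k + 1) * ρ + ρ - 1)) := by
          gcongr
          exact sum_rpow_mul_rpow_le (by positivity) hρ hρ1 (by omega)
      _ = _ := by
          rw [cCoef]
          push_cast
          ring_nf

/-- One-sided regular variation bound, the only consequence of Potter's bound that is needed. -/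
def WeightBound (w : ℕ → ℝ) (ρ C : ℝ) : Prop :=
  ∀ m n : ℕ, 1 ≤ m → m ≤ n → w m ≤ C * w n * ((m : ℝ) / n) ^ (ρ - 1)

lemma exists_weightBound {w l : ℕ → ℝ} {ν : ℝ} (hl : LogSlow l)
    (hwl : ∀ n : ℕ, 1 ≤ n → w n = (n : ℝ) ^ (ν - 1) * Real.exp (l n)) {ε : ℝ} (hε : 0 < ε) :
    ∃ C : ℝ, 1 ≤ C ∧ WeightBound w (ν - ε) C := by
  obtain ⟨C, hC, h⟩ := hl.potter hε
  refine ⟨Real.exp C, Real.one_le_exp hC, fun m n hm hmn => ?_⟩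
  have hm0 : (0 : ℝ) < m := by exact_mod_cast hm
  have hn0 : (0 : ℝ) < n := hm0.trans_le (by exact_mod_cast hmn)
  have k1 := h m n hm hmn
  rw [hwl m hm, hwl n (hm.trans hmn)]
  have k2 : l m ≤ ε * Real.log (n / m) + C + l n := by
    linarith [(abs_le.1 k1).1]
  calc (m : ℝ) ^ (ν - 1) * Real.exp (l m)
      ≤ (m : ℝ) ^ (ν - 1) * Real.exp (ε * Real.log (n / m) + C + l n) := by gcongr
    _ = _ := by
      rw [Real.exp_add, Real.exp_add, mul_comm ε, ← Real.rpow_def_of_pos (by positivity),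
        show ν - ε - 1 = (ν - 1) + (-ε) by ring, Real.rpow_add (by positivity),
        Real.div_rpow hm0.le hn0.le (ν - 1), ← inv_div (n : ℝ) m, Real.inv_rpow (by positivity),
        Real.rpow_neg (by positivity), inv_inv]
      field_simp

lemma gFun_le {w : ℕ → ℝ} (hw : ∀ n, 0 < w n) {ρ C : ℝ} (hρ : 0 < ρ) (hρ1 : ρ ≤ 1) (hC : 0 ≤ C)
    (hb : WeightBound w ρ C) (k : ℕ) {n : ℕ} (hn : 1 ≤ n) :
    gFun w k n ≤ C * (cCoef ρ k * (2 * C) ^ k) := by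
  have hn0 : (0 : ℝ) < n := by exact_mod_cast hn
  have hwn := hw n
  have h := convPow_le hw hρ hρ1 (P := C * w n * (n : ℝ) ^ (1 - ρ)) (by positivity) (K := n)
    (fun m hm hmn => by
      have hm0 : (0 : ℝ) < m := by exact_mod_cast hm
      refine (hb m n hm hmn).trans_eq ?_
      rw [Real.div_rpow hm0.le hn0.le, div_eq_mul_inv, ← Real.rpow_neg hn0.le, neg_sub]
      ring) k hn le_rfl
  rw [gFun, div_div, div_le_iff₀ (by positivity)]
  refine h.trans_eq ?_
  have e : ((n : ℝ) ^ (1 - ρ)) ^ (k + 1) * (n : ℝ) ^ ((k + 1) * ρ - 1) = (n : ℝ) ^ k := by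
    rw [← Real.rpow_natCast, ← Real.rpow_mul hn0.le, ← Real.rpow_add hn0, ← Real.rpow_natCast]
    congr 1
    push_cast
    ring
  rw [mul_pow (C * w n), mul_pow (n : ℝ), ← e]
  ring

lemma tendsto_weight_ratio {w l : ℕ → ℝ} {ν : ℝ} (hl : LogSlow l)
    (hwl : ∀ n : ℕ, 1 ≤ n → w n = (n : ℝ) ^ (ν - 1) * Real.exp (l n)) {m : ℕ → ℕ} {s : ℝ}
    (hs : 0 < s) (hmn : ∀ᶠ n in Filter.atTop, m n ≤ n)
    (hm : Filter.Tendsto (fun n : ℕ => (m n : ℝ) / n) Filter.atTop (nhds s)) :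
    Filter.Tendsto (fun n => w (m n) / w n) Filter.atTop (nhds (s ^ (ν - 1))) := by
  have hlow := (tendsto_order.1 hm).1 (s / 2) (by linarith)
  have hdiff : Filter.Tendsto (fun n => l n - l (m n)) Filter.atTop (nhds 0) := by
    rw [Metric.tendsto_nhds]
    intro ε hε
    obtain ⟨X, hX1, hX⟩ := hl (max 1 (2 / s)) (le_max_left _ _) (ε / 2) (by positivity)
    filter_upwards [hlow, hmn, Filter.eventually_gt_atTop 0,
      (tendsto_natCast_atTop_atTop (R := ℝ)).eventually_ge_atTop (2 / s * X)] with n h1 h2 h3 h4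
    have hn0 : (0 : ℝ) < n := by exact_mod_cast h3
    rw [lt_div_iff₀ hn0] at h1
    have h5 : (n : ℝ) ≤ 2 / s * m n := by
      rw [div_mul_eq_mul_div, le_div_iff₀ hs]; linarith
    have h6 : (X : ℝ) ≤ m n := by
      have := h4.trans h5
      exact le_of_mul_le_mul_left this (by positivity)
    rw [Real.dist_eq, sub_zero]
    have := hX (m n) n (by exact_mod_cast h6) h2
      (h5.trans (by gcongr; exact le_max_right _ _))
    linarith
  have hexp : Filter.Tendsto (fun n => Real.exp (-(l n - l (m n)))) Filter.atTop (nhds 1) := by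
    have h0 := hdiff.neg
    rw [neg_zero] at h0
    simpa using h0.rexp
  have h := (hm.rpow_const (p := ν - 1) (Or.inl hs.ne')).mul hexp
  rw [mul_one] at h
  refine h.congr' ?_
  filter_upwards [hlow, Filter.eventually_gt_atTop 0] with n h1 h3
  have hn0 : (0 : ℝ) < n := by exact_mod_cast h3
  rw [lt_div_iff₀ hn0] at h1
  have hm0 : (0 : ℝ) < m n := lt_trans (by positivity) h1
  rw [hwl n h3, hwl (m n) (by exact_mod_cast hm0), Real.div_rpow hm0.le hn0.le, neg_sub,
    Real.exp_sub, div_mul_div_comm]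

lemma tendsto_floor_div {s : ℝ} (hs : 0 ≤ s) :
    Filter.Tendsto (fun n : ℕ => (⌊n * s⌋₊ : ℝ) / n) Filter.atTop (nhds s) := by
  have := (tendsto_nat_floor_mul_div_atTop hs).comp (tendsto_natCast_atTop_atTop (R := ℝ))
  simpa [Function.comp_def, mul_comm] using this

lemma gFun_succ {w : ℕ → ℝ} (hw : ∀ n, 0 < w n) (k : ℕ) {n : ℕ} (hn : 1 ≤ n) :
    gFun w (k + 1) n = (∑ m ∈ Finset.Ioo 0 n, gFun w k m * (m * w m / (n * w n)) ^ k *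
      (w m / w n) * (w (n - m) / w n)) / n := by
  have hn0 : (0 : ℝ) < n := by exact_mod_cast hn
  have hwn := hw n
  rw [gFun, convPow, Finset.sum_div, Finset.sum_div, Finset.sum_div]
  refine Finset.sum_congr rfl fun m hm => ?_
  have hm0 : (0 : ℝ) < m := by exact_mod_cast (Finset.mem_Ioo.1 hm).1
  have hwm := hw m
  have h1 : ((m : ℝ) * w m) ^ k ≠ 0 := by positivity
  have h2 : ((n : ℝ) * w n) ^ k ≠ 0 := by positivity
  rw [gFun, div_pow, pow_succ]
  generalize ((m : ℝ) * w m) ^ k = P at h1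
  generalize ((n : ℝ) * w n) ^ k = Q at h2
  field_simp

lemma WeightBound.ratio_le {w : ℕ → ℝ} (hw : ∀ n, 0 < w n) {ρ C : ℝ} (hb : WeightBound w ρ C)
    {m n : ℕ} (hm : 1 ≤ m) (hmn : m ≤ n) : w m / w n ≤ C * ((m : ℝ) / n) ^ (ρ - 1) := by
  rw [div_le_iff₀ (hw n)]
  exact (hb m n hm hmn).trans_eq (by ring)

lemma WeightBound.mul_ratio_le {w : ℕ → ℝ} (hw : ∀ n, 0 < w n) {ρ C : ℝ} (hb : WeightBound w ρ C)
    {m n : ℕ} (hm : 1 ≤ m) (hmn : m ≤ n) : m * w m / (n * w n) ≤ C * ((m : ℝ) / n) ^ ρ := by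
  have hm0 : (0 : ℝ) < m := by exact_mod_cast hm
  have hn0 : (0 : ℝ) < n := hm0.trans_le (by exact_mod_cast hmn)
  rw [mul_div_mul_comm]
  calc (m : ℝ) / n * (w m / w n) ≤ m / n * (C * ((m : ℝ) / n) ^ (ρ - 1)) := by
        gcongr; exact hb.ratio_le hw hm hmn
    _ = _ := by
      rw [mul_left_comm, Real.rpow_sub_one (by positivity)]
      field_simp

lemma tendsto_gFun {w l : ℕ → ℝ} (hw : ∀ n, 0 < w n) {ν : ℝ} (hl : LogSlow l)
    (hwl : ∀ n : ℕ, 1 ≤ n → w n = (n : ℝ) ^ (ν - 1) * Real.exp (l n)) {ρ C : ℝ}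
    (hρ : 0 < ρ) (hρ1 : ρ ≤ 1) (hC : 0 ≤ C) (hb : WeightBound w ρ C) (k : ℕ) :
    Filter.Tendsto (fun n => gFun w k n) Filter.atTop (nhds (cCoef ν k)) := by
  induction k with
  | zero =>
    refine tendsto_const_nhds.congr fun n => ?_
    simp [gFun, cCoef, convPow, (hw n).ne']
  | succ k ih =>
    set Φ : ℕ → ℕ → ℝ := fun n m => if m = 0 then 0 else
      gFun w k m * (m * w m / (n * w n)) ^ k * (w m / w n) * (w (n - m) / w n) with hΦ
    have hg : ∀ᶠ n : ℕ in Filter.atTop,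
        ∫ s in Set.Ioo (0 : ℝ) 1, Φ n ⌊n * s⌋₊ = gFun w (k + 1) n := by
      filter_upwards [Filter.eventually_gt_atTop 0] with n hn
      rw [(integral_floor (Φ := Φ n) hn).2, gFun_succ hw k hn, sum_Ioo_eq_sum_range hn]
    refine Filter.Tendsto.congr' hg ?_
    rw [cCoef, betaI, ← integral_const_mul]
    set D := C * (cCoef ρ k * (2 * C) ^ k)
    have hD : 0 ≤ D := by have := cCoef_nonneg ρ k; positivity
    refine tendsto_integral_filter_of_dominated_convergence
      (fun s => D * C ^ k * (2 * C) * C * (s ^ (ρ - 1) * (1 - s) ^ (ρ - 1))) ?_ ?_ ?_ ?_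
    · filter_upwards [Filter.eventually_gt_atTop 0] with n hn
      exact (integral_floor (Φ := Φ n) hn).1.aestronglyMeasurable
    · filter_upwards [Filter.eventually_gt_atTop 0] with n hn
      filter_upwards [ae_restrict_mem measurableSet_Ioo] with s hs
      have hs0 := hs.1
      have hs1 : 0 < 1 - s := by linarith [hs.2]
      have hn0 : (0 : ℝ) < n := by exact_mod_cast hn
      have hlt := floor_mul_lt hn hs.2
      by_cases hm : ⌊n * s⌋₊ = 0
      · simp only [hΦ, hm, if_true, norm_zero]
        positivity
      · simp only [hΦ, if_neg hm]
        have hfl := rpow_floor_le (n := n) hρ hs0 hm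
        have hfs := rpow_sub_floor_le (n := n) hρ1 hn hs0 hs.2
        rw [← Nat.cast_sub hlt.le] at hfs
        set m := ⌊n * s⌋₊
        have hm1 : 1 ≤ m := Nat.one_le_iff_ne_zero.2 hm
        have hm0 : (0 : ℝ) < m := by exact_mod_cast hm1
        have hle : (m : ℝ) / n ≤ 1 := by
          rw [div_le_one hn0]; exact_mod_cast hlt.le
        have p1 := gFun_nonneg hw k m
        have p2 := hw m
        have p3 := hw n
        have p4 := hw (n - m)
        have hnρ : 0 < (n : ℝ) ^ (ρ - 1) := by positivity
        rw [Real.norm_of_nonneg (by positivity)]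
        have b1 : gFun w k m ≤ D := gFun_le hw hρ hρ1 hC hb k hm1
        have b2 : m * w m / (n * w n) ≤ C :=
          (hb.mul_ratio_le hw hm1 hlt.le).trans
            (mul_le_of_le_one_right hC (Real.rpow_le_one (by positivity) hle hρ.le))
        have b3 : w m / w n ≤ (2 * C) * s ^ (ρ - 1) := by
          refine (hb.ratio_le hw hm1 hlt.le).trans ?_
          rw [mul_comm 2 C, mul_assoc]
          refine mul_le_mul_of_nonneg_left ?_ hC
          rw [Real.div_rpow hm0.le hn0.le, div_le_iff₀ hnρ]
          rw [Real.mul_rpow hn0.le hs0.le] at hfl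
          linarith
        have b4 : w (n - m) / w n ≤ C * (1 - s) ^ (ρ - 1) := by
          refine (hb.ratio_le hw (by omega) (Nat.sub_le _ _)).trans ?_
          refine mul_le_mul_of_nonneg_left ?_ hC
          rw [Real.div_rpow (by positivity) hn0.le, div_le_iff₀ hnρ]
          rw [Real.mul_rpow hn0.le hs1.le] at hfs
          linarith
        calc _ ≤ D * C ^ k * ((2 * C) * s ^ (ρ - 1)) * (C * (1 - s) ^ (ρ - 1)) := by gcongr
          _ = _ := by ring
    · exact (integrableOn_beta hρ hρ).const_mul _
    · filter_upwards [ae_restrict_mem measurableSet_Ioo] with s hs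
      have hs0 := hs.1
      have hs1 : 0 < 1 - s := by linarith [hs.2]
      have hmt := tendsto_floor_div hs0.le
      have hlt : ∀ᶠ n : ℕ in Filter.atTop, ⌊n * s⌋₊ ≤ n := by
        filter_upwards [Filter.eventually_gt_atTop 0] with n hn
        exact (floor_mul_lt hn hs.2).le
      have hmt' : Filter.Tendsto (fun n : ℕ => ((n - ⌊n * s⌋₊ : ℕ) : ℝ) / n) Filter.atTop
          (nhds (1 - s)) := by
        refine (hmt.const_sub 1).congr' ?_
        filter_upwards [Filter.eventually_gt_atTop 0, hlt] with n hn h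
        have hn0 : (0 : ℝ) < n := by exact_mod_cast hn
        rw [Nat.cast_sub h]
        field_simp
      have r1 := tendsto_weight_ratio hl hwl hs0 hlt hmt
      have r2 := tendsto_weight_ratio hl hwl hs1 (Filter.Eventually.of_forall fun n =>
        Nat.sub_le n ⌊n * s⌋₊) hmt'
      have hinf : Filter.Tendsto (fun n : ℕ => ⌊n * s⌋₊) Filter.atTop Filter.atTop :=
        tendsto_nat_floor_atTop.comp
          ((tendsto_natCast_atTop_atTop (R := ℝ)).atTop_mul_const hs0)
      have r3 := (((ih.comp hinf).mul ((hmt.mul r1).pow k)).mul r1).mul r2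
      have e : cCoef ν k * (s * s ^ (ν - 1)) ^ k * s ^ (ν - 1) * (1 - s) ^ (ν - 1) =
          cCoef ν k * (s ^ ((k + 1) * ν - 1) * (1 - s) ^ (ν - 1)) := by
        have : s * s ^ (ν - 1) = s ^ ν := by
          rw [Real.rpow_sub_one hs0.ne']; field_simp
        rw [this, mul_assoc (cCoef ν k), ← Real.rpow_natCast, ← Real.rpow_mul hs0.le,
          ← Real.rpow_add hs0]
        ring_nf
      rw [e] at r3
      refine r3.congr' ?_
      filter_upwards [hinf.eventually_gt_atTop 0] with n hn
      simp only [hΦ, if_neg hn.ne', Function.comp, mul_div_mul_comm]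

/-- The limiting power series. -/
noncomputable def limSeries (ν x : ℝ) : ℝ := ∑' k : ℕ, cCoef ν k * x ^ k

lemma PsiHatCons_eq {ν : ℝ} (hν : ν ∈ Set.Ioo (0 : ℝ) 1) (d : ℝ) {t : ℝ} (ht : 0 ≤ t) :
    PsiHatCons ν d t = limSeries ν (d * t ^ ν) := by
  rw [limSeries, (summable_cCoef hν.1 _).tsum_eq_zero_add, PsiHatCons]
  congr 1
  · simp [cCoef]
  · refine tsum_congr fun k => ?_
    rw [simplexIntCons_eq hν ht, mul_pow]
    ring

lemma continuous_limSeries {ν : ℝ} (hν : 0 < ν) : Continuous (limSeries ν) := by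
  rw [continuous_iff_continuousAt]
  intro x
  have h : ContinuousOn (limSeries ν) (Metric.ball 0 (|x| + 1)) := by
    refine continuousOn_tsum (u := fun k => cCoef ν k * (|x| + 1) ^ k) (fun k => by fun_prop)
      (summable_cCoef hν _) fun k y hy => ?_
    rw [mem_ball_zero_iff, Real.norm_eq_abs] at hy
    rw [norm_mul, norm_pow, Real.norm_of_nonneg (cCoef_nonneg ν k), Real.norm_eq_abs]
    have := cCoef_nonneg ν k
    gcongr
  exact h.continuousAt (Metric.isOpen_ball.mem_nhds (by simp))

/-- Hypotheses on the weights and constants under which the series expansions are compared. -/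
structure GoodWeight (w l : ℕ → ℝ) (ν C : ℝ) : Prop where
  pos : ∀ n, 0 < w n
  nu_pos : 0 < ν
  nu_lt : ν < 1
  slow : LogSlow l
  eq : ∀ n : ℕ, 1 ≤ n → w n = (n : ℝ) ^ (ν - 1) * Real.exp (l n)
  one_le : 1 ≤ C
  bound : WeightBound w (ν / 2) C

namespace GoodWeight

variable {w l : ℕ → ℝ} {ν C : ℝ}

/-- Dominating coefficients for `gFun`. -/
noncomputable def dom (ν C : ℝ) (k : ℕ) : ℝ := C * (cCoef (ν / 2) k * (2 * C) ^ k)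

lemma gFun_le_dom (h : GoodWeight w l ν C) (k : ℕ) {n : ℕ} (hn : 1 ≤ n) :
    gFun w k n ≤ dom ν C k :=
  gFun_le h.pos (half_pos h.nu_pos) (by linarith [h.nu_lt]) (by linarith [h.one_le]) h.bound k hn

lemma tendsto (h : GoodWeight w l ν C) (k : ℕ) :
    Filter.Tendsto (fun n => gFun w k n) Filter.atTop (nhds (cCoef ν k)) :=
  tendsto_gFun h.pos h.slow h.eq (half_pos h.nu_pos) (by linarith [h.nu_lt])
    (by linarith [h.one_le]) h.bound k

lemma cCoef_le_dom (h : GoodWeight w l ν C) (k : ℕ) : cCoef ν k ≤ dom ν C k :=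
  le_of_tendsto (h.tendsto k) (by
    filter_upwards [Filter.eventually_ge_atTop 1] with n hn
    exact h.gFun_le_dom k hn)

lemma summable_dom (h : GoodWeight w l ν C) (x : ℝ) : Summable fun k => dom ν C k * x ^ k := by
  have := (summable_cCoef (half_pos h.nu_pos) (2 * C * x)).mul_left C
  refine this.congr fun k => ?_
  rw [dom, mul_pow (2 * C)]
  ring

lemma abs_sub_le_dom (h : GoodWeight w l ν C) (k : ℕ) {n : ℕ} (hn : 1 ≤ n) :
    |gFun w k n - cCoef ν k| ≤ dom ν C k := by
  rw [abs_le]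
  constructor <;> linarith [h.gFun_le_dom k hn, h.cCoef_le_dom k, cCoef_nonneg ν k,
    gFun_nonneg h.pos k n]

lemma summable_gFun (h : GoodWeight w l ν C) {n : ℕ} (hn : 1 ≤ n) (x : ℝ) :
    Summable fun k => gFun w k n * x ^ k := by
  refine Summable.of_norm_bounded (h.summable_dom |x|) fun k => ?_
  rw [norm_mul, norm_pow, Real.norm_of_nonneg (gFun_nonneg h.pos k n), Real.norm_eq_abs]
  gcongr
  exact h.gFun_le_dom k hn

lemma abs_tsum_sub_le (h : GoodWeight w l ν C) {n : ℕ} (hn : 1 ≤ n) {x R : ℝ} (hx : |x| ≤ R) :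
    |∑' k, gFun w k n * x ^ k - limSeries ν x| ≤
      ∑' k, |gFun w k n - cCoef ν k| * R ^ k := by
  rw [limSeries, ← (h.summable_gFun hn x).tsum_sub (summable_cCoef h.nu_pos x), ← Real.norm_eq_abs]
  have hR : 0 ≤ R := (abs_nonneg x).trans hx
  have hs : Summable fun k => |gFun w k n - cCoef ν k| * R ^ k := by
    refine Summable.of_nonneg_of_le (fun k => by positivity) (fun k => ?_) (h.summable_dom R)
    gcongr
    exact h.abs_sub_le_dom k hn
  refine tsum_of_norm_bounded hs.hasSum fun k => ?_
  rw [← sub_mul, norm_mul, norm_pow, Real.norm_eq_abs, Real.norm_eq_abs]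
  gcongr

lemma tendsto_tsum_abs (h : GoodWeight w l ν C) {R : ℝ} (hR : 0 ≤ R) :
    Filter.Tendsto (fun n => ∑' k, |gFun w k n - cCoef ν k| * R ^ k) Filter.atTop (nhds 0) := by
  rw [show nhds (0 : ℝ) = nhds (∑' k : ℕ, (0 : ℝ)) by simp]
  refine tendsto_tsum_of_dominated_convergence (h.summable_dom R) (fun k => ?_) ?_
  · have := (((h.tendsto k).sub_const (cCoef ν k)).abs).mul_const (R ^ k)
    simpa using this
  · filter_upwards [Filter.eventually_ge_atTop 1] with n hn k
    rw [Real.norm_of_nonneg (by positivity)]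
    gcongr
    exact h.abs_sub_le_dom k hn

lemma abs_tsum_sub_le_small (h : GoodWeight w l ν C) :
    ∃ K : ℝ, 0 ≤ K ∧ ∀ n : ℕ, 1 ≤ n → ∀ x : ℝ, |x| ≤ 1 →
      |∑' k, gFun w k n * x ^ k - limSeries ν x| ≤ K * |x| := by
  have hs := h.summable_dom 1
  simp only [one_pow, mul_one] at hs
  have hs1 := (summable_nat_add_iff 1).2 hs
  have hd : ∀ k, 0 ≤ dom ν C k := fun k => (cCoef_nonneg ν k).trans (h.cCoef_le_dom k)
  refine ⟨∑' k, dom ν C (k + 1), tsum_nonneg fun k => hd _, fun n hn x hx => ?_⟩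
  refine (h.abs_tsum_sub_le hn le_rfl).trans ?_
  have hsum : Summable fun k => |gFun w k n - cCoef ν k| * |x| ^ k := by
    refine Summable.of_nonneg_of_le (fun k => by positivity) (fun k => ?_) (h.summable_dom |x|)
    gcongr
    exact h.abs_sub_le_dom k hn
  rw [hsum.tsum_eq_zero_add, ← tsum_mul_right]
  have h0 : gFun w 0 n - cCoef ν 0 = 0 := by simp [gFun, cCoef, convPow, (h.pos n).ne']
  rw [h0, abs_zero, zero_mul, zero_add]
  refine Summable.tsum_le_tsum (fun k => ?_) ((summable_nat_add_iff 1).2 hsum) (hs1.mul_right _)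
  rw [pow_succ]
  have : |x| ^ k ≤ 1 := pow_le_one₀ (abs_nonneg x) hx
  refine mul_le_mul (h.abs_sub_le_dom _ hn) (mul_le_of_le_one_left (abs_nonneg x) this)
    (by positivity) (hd _)

lemma tendsto_mul_weight (h : GoodWeight w l ν C) :
    Filter.Tendsto (fun n : ℕ => n * w n) Filter.atTop Filter.atTop := by
  have hw1 := h.pos 1
  have hC : 0 < C := by linarith [h.one_le]
  have ht : Filter.Tendsto (fun n : ℕ => w 1 / C * (n : ℝ) ^ (ν / 2)) Filter.atTop Filter.atTop :=
    ((tendsto_rpow_atTop (half_pos h.nu_pos)).comp tendsto_natCast_atTop_atTop).const_mul_atTop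
      (by positivity)
  refine Filter.tendsto_atTop_mono' _ ?_ ht
  filter_upwards [Filter.eventually_ge_atTop 1] with n hn
  have hn0 : (0 : ℝ) < n := by exact_mod_cast hn
  have hwn := h.pos n
  have := h.bound.mul_ratio_le h.pos le_rfl hn
  rw [Nat.cast_one, one_mul, Real.div_rpow zero_le_one hn0.le, Real.one_rpow, mul_one_div,
    div_le_div_iff₀ (by positivity) (by positivity)] at this
  rw [div_mul_eq_mul_div, div_le_iff₀ hC]
  linarith

lemma mul_weight_ratio (h : GoodWeight w l ν C) {n N : ℕ} (hn : 1 ≤ n) (hN : 1 ≤ N) :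
    n * w n / (N * w N) = ((n : ℝ) / N) ^ ν * Real.exp (l n - l N) := by
  have hn0 : (0 : ℝ) < n := by exact_mod_cast hn
  have hN0 : (0 : ℝ) < N := by exact_mod_cast hN
  rw [h.eq n hn, h.eq N hN, Real.exp_sub, Real.rpow_sub_one hn0.ne', Real.rpow_sub_one hN0.ne',
    Real.div_rpow hn0.le hN0.le]
  field_simp

lemma eventually_abs_ratio_sub_le (h : GoodWeight w l ν C) {T ε : ℝ} (hT : 1 ≤ T) (hε : 0 < ε) :
    ∀ᶠ N : ℕ in Filter.atTop, ∀ n : ℕ, 1 ≤ n → (n : ℝ) ≤ T * N →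
      |n * w n / (N * w N) - ((n : ℝ) / N) ^ ν| ≤ ε := by
  have hν := h.nu_pos
  have hC := h.one_le
  obtain ⟨r, hr0, hr⟩ : ∃ r : ℝ, 0 < r ∧ C * r ^ (ν / 2) ≤ ε := by
    refine ⟨(ε / C) ^ (ν / 2)⁻¹, by positivity, ?_⟩
    rw [Real.rpow_inv_rpow (by positivity) (by positivity)]
    field_simp
    exact le_rfl
  set T' := max T (1 / r)
  have hT' : 1 ≤ T' := hT.trans (le_max_left _ _)
  set η := min 1 (ε / (2 * T ^ ν))
  have hη : 0 < η := by positivity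
  obtain ⟨X, hX1, hX⟩ := h.slow T' hT' η hη
  filter_upwards [Filter.eventually_ge_atTop X,
    (tendsto_natCast_atTop_atTop (R := ℝ)).eventually_ge_atTop (X / r)] with N hNX hNr n hn hnT
  have hN1 : 1 ≤ N := hX1.trans hNX
  have hn0 : (0 : ℝ) < n := by exact_mod_cast hn
  have hN0 : (0 : ℝ) < N := by exact_mod_cast hN1
  have hwn := h.pos n
  have hwN := h.pos N
  have far : X ≤ n → |l n - l N| ≤ η →
      |n * w n / (N * w N) - ((n : ℝ) / N) ^ ν| ≤ ε := by
    intro _ hd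
    rw [h.mul_weight_ratio hn hN1, ← mul_sub_one, abs_mul, abs_of_nonneg (by positivity)]
    have e1 := Real.abs_exp_sub_one_le (hd.trans (min_le_left _ _))
    have e2 : ((n : ℝ) / N) ^ ν ≤ T ^ ν := by
      gcongr
      rwa [div_le_iff₀ hN0]
    calc _ ≤ T ^ ν * (2 * η) := by
          gcongr
          exact e1.trans (by gcongr)
      _ ≤ T ^ ν * (2 * (ε / (2 * T ^ ν))) := by gcongr; exact min_le_right _ _
      _ = ε := by field_simp
  rcases le_total N n with hNn | hnN
  · exact far (hNX.trans hNn) (hX N n hNX hNn (hnT.trans (by gcongr; exact le_max_left _ _)))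
  · by_cases hrn : (n : ℝ) / N ≤ r
    · have b1 := (h.bound.mul_ratio_le h.pos hn hnN).trans
        (mul_le_mul_of_nonneg_left (Real.rpow_le_rpow (by positivity) hrn (by positivity))
          (by linarith))
      have hle : (n : ℝ) / N ≤ 1 := by
        rw [div_le_one hN0]; exact_mod_cast hnN
      have b2 : ((n : ℝ) / N) ^ ν ≤ r ^ (ν / 2) :=
        (Real.rpow_le_rpow_of_exponent_ge (by positivity) hle (by linarith)).trans
          (Real.rpow_le_rpow (by positivity) hrn (by positivity))
      have b3 : r ^ (ν / 2) ≤ C * r ^ (ν / 2) := le_mul_of_one_le_left (by positivity) hC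
      have p1 : 0 ≤ n * w n / (N * w N) := by positivity
      have p2 : 0 ≤ ((n : ℝ) / N) ^ ν := by positivity
      rw [abs_le]
      constructor <;> linarith
    · push Not at hrn
      rw [lt_div_iff₀ hN0] at hrn
      rw [div_le_iff₀ hr0] at hNr
      have hXn : X ≤ n := by
        have : (X : ℝ) ≤ n := by linarith
        exact_mod_cast this
      refine far hXn ?_
      rw [abs_sub_comm]
      refine hX n N hXn hnN ?_
      have : (N : ℝ) ≤ 1 / r * n := by
        rw [div_mul_eq_mul_div, le_div_iff₀ hr0]; linarith
      exact this.trans (by gcongr; exact le_max_right _ _)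

lemma eventually_PsiCons_close (h : GoodWeight w l ν C) {d : ℝ} {δ : ℕ → ℝ}
    (hδ : Filter.Tendsto (fun N : ℕ => (Real.exp (δ N) - 1) * (N * w N)) Filter.atTop (nhds d))
    {T ε : ℝ} (hT : 1 ≤ T) (hε : 0 < ε) :
    ∀ᶠ N : ℕ in Filter.atTop, ∀ n : ℕ, (n : ℝ) ≤ T * N →
      |PsiCons w (δ N) n - limSeries ν (d * ((n : ℝ) / N) ^ ν)| ≤ ε := by
  have hν := h.nu_pos
  set R := |d| * T ^ ν + 1 with hR
  have hR0 : 0 ≤ R := by positivity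
  have hTν : 0 < T ^ ν := by positivity
  have huc : UniformContinuousOn (limSeries ν) (Set.Icc (-R) R) :=
    isCompact_Icc.uniformContinuousOn_of_continuous (continuous_limSeries hν).continuousOn
  obtain ⟨δ₁, hδ₁, hG⟩ := Metric.uniformContinuousOn_iff.1 huc (ε / 2) (half_pos hε)
  obtain ⟨n₀, hn₀⟩ := Filter.eventually_atTop.1
    ((tendsto_order.1 (h.tendsto_tsum_abs hR0)).2 (ε / 2) (half_pos hε))
  obtain ⟨K, hK, hsmall⟩ := h.abs_tsum_sub_le_small
  set δ₂ := min 1 (δ₁ / 2)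
  have hδ₂ : 0 < δ₂ := by positivity
  set ε₁ := min 1 (δ₂ / (T ^ ν + 1 + |d|))
  have hε₁ : 0 < ε₁ := by positivity
  have hε₁' : ε₁ * (T ^ ν + 1) + |d| * ε₁ ≤ δ₂ := by
    have : ε₁ ≤ δ₂ / (T ^ ν + 1 + |d|) := min_le_right _ _
    rw [le_div_iff₀ (by positivity)] at this
    linarith
  have ha : Filter.Tendsto (fun N => Real.exp (δ N) - 1) Filter.atTop (nhds 0) := by
    refine (hδ.div_atTop h.tendsto_mul_weight).congr' ?_
    filter_upwards [Filter.eventually_gt_atTop 0] with N hN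
    have hN0 : (0 : ℝ) < N := by exact_mod_cast hN
    have := h.pos N
    field_simp
  have hfin : ∀ᶠ N in Filter.atTop, ∀ n ∈ Finset.range n₀,
      |(Real.exp (δ N) - 1) * (n * w n)| < min 1 (ε / 2 / (K + 1)) := by
    rw [Filter.eventually_all_finset]
    intro n _
    have := (ha.mul_const (n * w n)).abs
    rw [zero_mul, abs_zero] at this
    exact (tendsto_order.1 this).2 _ (by positivity)
  filter_upwards [h.eventually_abs_ratio_sub_le hT hε₁, hfin, Filter.eventually_gt_atTop 0,
    Metric.tendsto_nhds.1 hδ ε₁ hε₁] with N hratio hfinN hN had n hnT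
  have hN0 : (0 : ℝ) < N := by exact_mod_cast hN
  rcases Nat.eq_zero_or_pos n with rfl | hn
  · have e : limSeries ν 0 = 1 := by
      rw [limSeries, tsum_eq_single 0 fun k hk => by simp [hk]]
      simp [cCoef]
    simp [PsiCons, Real.zero_rpow hν.ne', e, hε.le]
  rw [PsiCons_eq_tsum_gFun h.pos _ hn]
  set x := (Real.exp (δ N) - 1) * (n * w n) with hx
  have hn0 : (0 : ℝ) < n := by exact_mod_cast hn
  have hwN := h.pos N
  have hwn := h.pos n
  set q := n * w n / (N * w N) with hq
  set p := ((n : ℝ) / N) ^ ν with hp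
  have hp0 : 0 ≤ p := by positivity
  have hpT : p ≤ T ^ ν := by
    rw [hp]; gcongr; rwa [div_le_iff₀ hN0]
  have hqp := hratio n hn hnT
  have hq0 : 0 ≤ q := by positivity
  have hqT : q ≤ T ^ ν + 1 := by
    have := (abs_le.1 hqp).2
    have : ε₁ ≤ 1 := min_le_left _ _
    linarith
  have hxq : x = (Real.exp (δ N) - 1) * (N * w N) * q := by
    rw [hx, hq]; field_simp
  rw [Real.dist_eq] at had
  have hxy : |x - d * p| ≤ δ₂ := by
    have e : x - d * p = ((Real.exp (δ N) - 1) * (N * w N) - d) * q + d * (q - p) := by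
      rw [hxq]; ring
    rw [e]
    refine (abs_add_le _ _).trans (le_trans ?_ hε₁')
    rw [abs_mul, abs_mul, abs_of_nonneg hq0]
    gcongr
  have hy : |d * p| ≤ |d| * T ^ ν := by
    rw [abs_mul, abs_of_nonneg hp0]; gcongr
  have hxR : |x| ≤ R := by
    have := abs_sub_abs_le_abs_sub x (d * p)
    have : δ₂ ≤ 1 := min_le_left _ _
    linarith
  have c1 : |limSeries ν x - limSeries ν (d * p)| < ε / 2 := by
    refine hG x (abs_le.1 hxR) (d * p) (abs_le.1 (by linarith)) ?_
    rw [Real.dist_eq]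
    have : δ₂ ≤ δ₁ / 2 := min_le_right _ _
    linarith
  have c2 : |∑' k, gFun w k n * x ^ k - limSeries ν x| ≤ ε / 2 := by
    by_cases hnn : n₀ ≤ n
    · exact (h.abs_tsum_sub_le hn hxR).trans (hn₀ n hnn).le
    · have hb := hfinN n (Finset.mem_range.2 (not_le.1 hnn))
      refine (hsmall n hn x (hb.le.trans (min_le_left _ _))).trans ?_
      have : |x| ≤ ε / 2 / (K + 1) := hb.le.trans (min_le_right _ _)
      rw [le_div_iff₀ (by positivity)] at this
      nlinarith [abs_nonneg x]
  have := abs_sub_le (∑' k, gFun w k n * x ^ k) (limSeries ν x) (limSeries ν (d * p))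
  linarith

end GoodWeight

lemma interp_mem_close {F : ℕ → ℝ} {x y ε : ℝ} (hx : 0 ≤ x) (h0 : |F ⌊x⌋₊ - y| ≤ ε)
    (h1 : |F (⌊x⌋₊ + 1) - y| ≤ ε) : |interp F x - y| ≤ ε := by
  have a := Nat.floor_le hx
  have b := Nat.lt_floor_add_one x
  unfold interp
  rw [abs_le] at *
  constructor <;> nlinarith

/-- If `w(n) M(n) n^{1-ν} → 1` with `M` slowly varying, and
`δ_N = δ̂ M(N) N^{-ν}`, then the linearly interpolated constrained partition functions
`Ψ^c_{δ_N}(Nt)` converge to `Ψ̂^{ν,c}_{δ̂}(t)` uniformly on `[0,T]`; moreover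
`Ψ̂^{ν,c}_{δ̂}(t)` is finite for every `t ≥ 0`. -/
theorem stmt_4 (ν : ℝ) (hν : ν ∈ Set.Ioo (0:ℝ) 1)
    (M : ℝ → ℝ) (hM_pos : ∀ x : ℝ, 0 < x → 0 < M x) (hM_meas : Measurable M)
    (hM_slow : ∀ c : ℝ, 0 < c →
      Filter.Tendsto (fun x : ℝ => M (c * x) / M x) Filter.atTop (nhds 1))
    (w : ℕ → ℝ) (hw_pos : ∀ n, 0 < w n)
    (hw_asymp : Filter.Tendsto (fun n : ℕ => w n * M n * (n : ℝ) ^ (1 - ν))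
      Filter.atTop (nhds 1))
    (dh : ℝ) (δ : ℕ → ℝ) (hδ : ∀ N : ℕ, δ N = dh * M N / (N : ℝ) ^ ν) :
    (∀ T : ℝ, 0 < T →
      TendstoUniformlyOn (fun (N : ℕ) (t : ℝ) => interp (PsiCons w (δ N)) ((N : ℝ) * t))
        (fun t => PsiHatCons ν dh t) Filter.atTop (Set.Icc 0 T))
    ∧ (∀ t : ℝ, 0 ≤ t →
        (∀ k : ℕ, simplexIntLCons ν t k ≠ ⊤)
        ∧ Summable (fun k : ℕ => dh ^ (k + 1) * simplexIntCons ν t k)) := by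
  have hν0 := hν.1
  have hν1 := hν.2
  have hslow := logSlow_of_slowlyVarying hM_pos hM_meas hM_slow hw_pos hw_asymp
  have hwl : ∀ n : ℕ, 1 ≤ n → w n = (n : ℝ) ^ (ν - 1) *
      Real.exp (Real.log (w n * (n : ℝ) ^ (1 - ν))) := by
    intro n hn
    have hn0 : (0 : ℝ) < n := by exact_mod_cast hn
    have := hw_pos n
    rw [Real.exp_log (by positivity), mul_left_comm, ← Real.rpow_add hn0]
    simp
  obtain ⟨C, hC, hb⟩ := exists_weightBound hslow hwl (half_pos hν0)
  rw [sub_half] at hb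
  have good : GoodWeight w (fun n => Real.log (w n * (n : ℝ) ^ (1 - ν))) ν C :=
    ⟨hw_pos, hν0, hν1, hslow, hwl, hC, hb⟩
  have hprod : Filter.Tendsto (fun N : ℕ => δ N * (N * w N)) Filter.atTop (nhds dh) := by
    have := hw_asymp.const_mul dh
    rw [mul_one] at this
    refine this.congr' ?_
    filter_upwards [Filter.eventually_gt_atTop 0] with N hN
    have hN0 : (0 : ℝ) < N := by exact_mod_cast hN
    rw [hδ, Real.rpow_sub hN0, Real.rpow_one]
    field_simp
  have hδ0 : Filter.Tendsto δ Filter.atTop (nhds 0) := by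
    refine (hprod.div_atTop good.tendsto_mul_weight).congr' ?_
    filter_upwards [Filter.eventually_gt_atTop 0] with N hN
    have hN0 : (0 : ℝ) < N := by exact_mod_cast hN
    have := hw_pos N
    field_simp
  have hexp : Filter.Tendsto (fun N : ℕ => (Real.exp (δ N) - 1) * (N * w N)) Filter.atTop
      (nhds dh) := by
    have hdiff : Filter.Tendsto (fun N : ℕ => (Real.exp (δ N) - 1 - δ N) * (N * w N))
        Filter.atTop (nhds 0) := by
      have hlim := hδ0.abs.mul hprod.abs
      rw [abs_zero, zero_mul] at hlim
      refine squeeze_zero_norm' ?_ hlim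
      have hev := (tendsto_order.1 hδ0.abs).2 1 (by simp)
      filter_upwards [hev] with N hN
      have h1 := Real.abs_exp_sub_one_sub_id_le hN.le
      rw [Real.norm_eq_abs, abs_mul, abs_mul (δ N), ← mul_assoc, ← sq, sq_abs]
      gcongr
    have := hdiff.add hprod
    rw [zero_add] at this
    exact this.congr fun N => by ring
  refine ⟨fun T hT => ?_, fun t ht => ⟨fun k => ?_, ?_⟩⟩
  · rw [Metric.tendstoUniformlyOn_iff]
    intro ε hε
    set H : ℝ → ℝ := fun t => limSeries ν (dh * t ^ ν) with hH
    have hHc : Continuous H := (continuous_limSeries hν0).comp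
      (continuous_const.mul (Real.continuous_rpow_const hν0.le))
    obtain ⟨r, hr, hHr⟩ := Metric.uniformContinuousOn_iff.1
      ((isCompact_Icc (a := (0 : ℝ)) (b := T + 1)).uniformContinuousOn_of_continuous
        hHc.continuousOn) (ε / 4) (by positivity)
    filter_upwards [good.eventually_PsiCons_close hexp (T := T + 1) (by linarith)
        (ε := ε / 4) (by positivity), Filter.eventually_gt_atTop 0,
      (tendsto_natCast_atTop_atTop (R := ℝ)).eventually_gt_atTop (1 / r)] with N hclose hN hNr t ht
    have hN0 : (0 : ℝ) < N := by exact_mod_cast hN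
    have hN1 : (1 : ℝ) ≤ N := by exact_mod_cast hN
    have hNt : 0 ≤ N * t := mul_nonneg hN0.le ht.1
    have hNT : N * t ≤ N * T := mul_le_mul_of_nonneg_left ht.2 hN0.le
    have hNr' : (N : ℝ)⁻¹ < r := by
      rw [inv_lt_comm₀ hN0 hr, ← one_div]; exact hNr
    have near : ∀ n : ℕ, (n : ℝ) ≤ N * t + 1 → N * t ≤ n + 1 →
        |PsiCons w (δ N) n - H t| ≤ ε / 2 := by
      intro n h1 h2
      have hnT : (n : ℝ) ≤ (T + 1) * N := by nlinarith
      have k1 := hclose n hnT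
      have k2 : dist (H ((n : ℝ) / N)) (H t) < ε / 4 := by
        refine hHr _ ⟨by positivity, by rwa [div_le_iff₀ hN0]⟩ _ ⟨ht.1, by linarith [ht.2]⟩ ?_
        rw [Real.dist_eq]
        refine lt_of_le_of_lt ?_ hNr'
        have e : (n : ℝ) / N - t = (n - N * t) * (N : ℝ)⁻¹ := by field_simp
        rw [e, abs_mul, abs_of_pos (inv_pos.2 hN0)]
        refine mul_le_of_le_one_left (inv_pos.2 hN0).le ?_
        rw [abs_le]
        constructor <;> linarith
      rw [Real.dist_eq] at k2
      have := abs_sub_le (PsiCons w (δ N) n) (H ((n : ℝ) / N)) (H t)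
      linarith
    have a := Nat.floor_le hNt
    have b := Nat.lt_floor_add_one (N * t)
    have := interp_mem_close hNt (near ⌊N * t⌋₊ (by linarith) (by linarith))
      (near (⌊N * t⌋₊ + 1) (by push_cast; linarith) (by push_cast; linarith))
    rw [PsiHatCons_eq hν dh ht.1, dist_comm, Real.dist_eq]
    change |_ - H t| < ε
    linarith
  · rw [simplexIntLCons_eq hν ht]
    exact ENNReal.ofReal_ne_top
  · have := (summable_nat_add_iff 1).2 (summable_cCoef hν0 (dh * t ^ ν))
    refine this.congr fun k => ?_
    rw [simplexIntCons_eq hν ht, mul_pow]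
    ring
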